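/- Let m, n ∈ ℕ and 0 ≤ ℓ < d. (i) If max(1, d/n) < p < ∞ and a ≥ d/p − n, then there exists a constant c such that ‖u·v | 𝒦^m_{a,p}(ℝ^d,ℝ^ℓ_*)‖ ≤ c ‖v | 𝒦^{m+n}_{a+n,p}(ℝ^d,ℝ^ℓ_*)‖ · ‖u | 𝒦^m_{a,p}(ℝ^d,ℝ^ℓ_*)‖ holds for all u ∈ 𝒦^m_{a,p}(ℝ^d,ℝ^ℓ_*) and v ∈ 𝒦^{m+n}_{a+n,p}(ℝ^d,ℝ^ℓ_*). (ii) If p = 1, d ≤ n and a ≥ d − n, then the same estimate holds. -/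

import Mathlib

open MeasureTheory Metric Set Filter
open scoped Topology ENNReal NNReal

noncomputable section

/-- `d`-dimensional Euclidean space. -/
abbrev Ed (d : ℕ) : Type := EuclideanSpace ℝ (Fin d)

/-- The finite set of all multi-indices `α : Fin d → ℕ` with `|α| = ∑ i, α i ≤ m`. -/
def multiIdx (d m : ℕ) : Finset (Fin d → ℕ) :=
  (Fintype.piFinset fun _ : Fin d => Finset.range (m + 1)).filter fun α => ∑ i, α i ≤ m

/-- First-order partial derivative in the `i`-th coordinate direction. -/
def pderivI (d : ℕ) (i : Fin d) (f : Ed d → ℝ) : Ed d → ℝ :=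
  fun x => fderiv ℝ f x (EuclideanSpace.single i 1)

/-- Iterated partial derivative `∂^α`. -/
def pderivA (d : ℕ) (α : Fin d → ℕ) (f : Ed d → ℝ) : Ed d → ℝ :=
  ((List.finRange d).foldr (fun i g => (pderivI d i)^[α i] ∘ g) id) f

/-- Smooth compactly supported test functions with support inside `Ω`. -/
def IsTestFun (d : ℕ) (Ω : Set (Ed d)) (φ : Ed d → ℝ) : Prop :=
  ContDiff ℝ (⊤ : ℕ∞) φ ∧ HasCompactSupport φ ∧ tsupport φ ⊆ Ω

/-- `v` is the `α`-th weak (distributional) derivative of `u` on `Ω`. -/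
def HasWeakDerivOn (d : ℕ) (Ω : Set (Ed d)) (α : Fin d → ℕ) (u v : Ed d → ℝ) : Prop :=
  LocallyIntegrableOn u Ω volume ∧ LocallyIntegrableOn v Ω volume ∧
    ∀ φ : Ed d → ℝ, IsTestFun d Ω φ →
      ∫ x in Ω, u x * pderivA d α φ x = (-1 : ℝ) ^ (∑ i, α i) * ∫ x in Ω, v x * φ x

/-- `D` is a family of weak derivatives of `u` on `Ω` for all multi-indices of order `≤ m`. -/
def IsWeakDerivFamily (d : ℕ) (Ω : Set (Ed d)) (m : ℕ) (u : Ed d → ℝ)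
    (D : (Fin d → ℕ) → Ed d → ℝ) : Prop :=
  ∀ α ∈ multiIdx d m, HasWeakDerivOn d Ω α u (D α)

/-- `x ↦ (ρ(x)^(|α|-a) |v(x)|)^p`, the integrand in the Kondratiev norm. -/
def kIntegrand (d : ℕ) (ρ : Ed d → ℝ) (a p : ℝ) (α : Fin d → ℕ) (v : Ed d → ℝ) : Ed d → ℝ :=
  fun x => (ρ x ^ (((∑ i, α i : ℕ) : ℝ) - a) * |v x|) ^ p

/-- The Kondratiev norm computed from a family `D` of weak derivatives. -/
def KnormP (d : ℕ) (Ω : Set (Ed d)) (ρ : Ed d → ℝ) (m : ℕ) (a p : ℝ)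
    (D : (Fin d → ℕ) → Ed d → ℝ) : ℝ :=
  (∑ α ∈ multiIdx d m, ∫ x in Ω, kIntegrand d ρ a p α (D α) x) ^ (1 / p)

/-- `D` witnesses membership of `u` in the Kondratiev space `𝒦^m_{a,p}(Ω, M)`
    (with weight function `ρ`). -/
def KMemData (d : ℕ) (Ω : Set (Ed d)) (ρ : Ed d → ℝ) (m : ℕ) (a p : ℝ)
    (u : Ed d → ℝ) (D : (Fin d → ℕ) → Ed d → ℝ) : Prop :=
  IsWeakDerivFamily d Ω m u D ∧
    ∀ α ∈ multiIdx d m, IntegrableOn (kIntegrand d ρ a p α (D α)) Ω volume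

/-- Membership in the Kondratiev space `𝒦^m_{a,p}(Ω, M)` with weight `ρ`, `p < ∞`. -/
def MemK (d : ℕ) (Ω : Set (Ed d)) (ρ : Ed d → ℝ) (m : ℕ) (a p : ℝ) (u : Ed d → ℝ) : Prop :=
  ∃ D, KMemData d Ω ρ m a p u D

open Classical in
/-- The Kondratiev norm of `u` (computed from a choice of weak derivative family;
    it is a.e. independent of this choice). -/
def Knorm (d : ℕ) (Ω : Set (Ed d)) (ρ : Ed d → ℝ) (m : ℕ) (a p : ℝ) (u : Ed d → ℝ) : ℝ :=
  if h : MemK d Ω ρ m a p u then KnormP d Ω ρ m a p h.choose else 0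

/-- `x ↦ ρ(x)^(|α|-a) v(x)`, the function whose `L_∞` norm enters the norm for `p = ∞`. -/
def kIntegrandInf (d : ℕ) (ρ : Ed d → ℝ) (a : ℝ) (α : Fin d → ℕ) (v : Ed d → ℝ) : Ed d → ℝ :=
  fun x => ρ x ^ (((∑ i, α i : ℕ) : ℝ) - a) * v x

/-- `D` witnesses membership of `u` in `𝒦^m_{a,∞}(Ω, M)`. -/
def KMemDataInf (d : ℕ) (Ω : Set (Ed d)) (ρ : Ed d → ℝ) (m : ℕ) (a : ℝ)
    (u : Ed d → ℝ) (D : (Fin d → ℕ) → Ed d → ℝ) : Prop :=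
  IsWeakDerivFamily d Ω m u D ∧
    ∀ α ∈ multiIdx d m,
      eLpNorm (kIntegrandInf d ρ a α (D α)) ⊤ (volume.restrict Ω) < ⊤

/-- Membership in `𝒦^m_{a,∞}(Ω, M)`. -/
def MemKInf (d : ℕ) (Ω : Set (Ed d)) (ρ : Ed d → ℝ) (m : ℕ) (a : ℝ) (u : Ed d → ℝ) : Prop :=
  ∃ D, KMemDataInf d Ω ρ m a u D

/-- The `𝒦^m_{a,∞}` norm computed from a family `D` of weak derivatives. -/
def KnormInfP (d : ℕ) (Ω : Set (Ed d)) (ρ : Ed d → ℝ) (m : ℕ) (a : ℝ)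
    (D : (Fin d → ℕ) → Ed d → ℝ) : ℝ :=
  ∑ α ∈ multiIdx d m, (eLpNorm (kIntegrandInf d ρ a α (D α)) ⊤ (volume.restrict Ω)).toReal

open Classical in
/-- The `𝒦^m_{a,∞}(Ω, M)` norm of `u`. -/
def KnormInf (d : ℕ) (Ω : Set (Ed d)) (ρ : Ed d → ℝ) (m : ℕ) (a : ℝ) (u : Ed d → ℝ) : ℝ :=
  if h : MemKInf d Ω ρ m a u then KnormInfP d Ω ρ m a h.choose else 0

/-- The subspace `ℝ^ℓ_* = {x : x₁ = ⋯ = x_{d-ℓ} = 0}` of `ℝ^d`. -/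
def RStar (d ℓ : ℕ) : Set (Ed d) := {x | ∀ i : Fin d, (i : ℕ) < d - ℓ → x i = 0}

/-- The weight `ρ(x) = min(1, |x'|)` for the model case `(ℝ^d, ℝ^ℓ_*)`. -/
def rhoModel (d ℓ : ℕ) (x : Ed d) : ℝ :=
  min 1 (Real.sqrt (∑ i ∈ Finset.univ.filter (fun i : Fin d => (i : ℕ) < d - ℓ), (x i) ^ 2))

/-- The model domain `ℝ^d ∖ ℝ^ℓ_*`. -/
def ModelDomain (d ℓ : ℕ) : Set (Ed d) := (RStar d ℓ)ᶜ

/-- Membership in the model Kondratiev space `𝒦^m_{a,p}(ℝ^d, ℝ^ℓ_*)`, `p < ∞`. -/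
def MemKM (d ℓ m : ℕ) (a p : ℝ) (u : Ed d → ℝ) : Prop :=
  MemK d (ModelDomain d ℓ) (rhoModel d ℓ) m a p u

/-- The norm of the model Kondratiev space `𝒦^m_{a,p}(ℝ^d, ℝ^ℓ_*)`, `p < ∞`. -/
def KnormM (d ℓ m : ℕ) (a p : ℝ) (u : Ed d → ℝ) : ℝ :=
  Knorm d (ModelDomain d ℓ) (rhoModel d ℓ) m a p u

/-- Membership in the model Kondratiev space `𝒦^m_{a,∞}(ℝ^d, ℝ^ℓ_*)`. -/
def MemKMInf (d ℓ m : ℕ) (a : ℝ) (u : Ed d → ℝ) : Prop :=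
  MemKInf d (ModelDomain d ℓ) (rhoModel d ℓ) m a u

/-- The norm of the model Kondratiev space `𝒦^m_{a,∞}(ℝ^d, ℝ^ℓ_*)`. -/
def KnormMInf (d ℓ m : ℕ) (a : ℝ) (u : Ed d → ℝ) : ℝ :=
  KnormInf d (ModelDomain d ℓ) (rhoModel d ℓ) m a u

/-! ### Partial derivatives of smooth functions -/

lemma pderivI_smooth {d : ℕ} (i : Fin d) {f : Ed d → ℝ} (hf : ContDiff ℝ (⊤ : ℕ∞) f) :
    ContDiff ℝ (⊤ : ℕ∞) (pderivI d i f) := by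
  unfold pderivI
  exact (hf.fderiv_right (m := (⊤ : ℕ∞)) (by simp)).clm_apply contDiff_const

lemma pderivI_comm {d : ℕ} (i j : Fin d) {f : Ed d → ℝ} (hf : ContDiff ℝ (⊤ : ℕ∞) f) :
    pderivI d i (pderivI d j f) = pderivI d j (pderivI d i f) := by
  have hd : Differentiable ℝ (fderiv ℝ f) :=
    (hf.fderiv_right (m := (⊤ : ℕ∞)) (by simp)).differentiable (by simp)
  funext x
  have key : ∀ k l : Fin d, pderivI d k (pderivI d l f) x =
      fderiv ℝ (fderiv ℝ f) x (EuclideanSpace.single k 1) (EuclideanSpace.single l 1) := by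
    intro k l
    unfold pderivI
    rw [fderiv_clm_apply (hd x) (by fun_prop)]
    simp
  rw [key, key]
  have hs : IsSymmSndFDerivAt ℝ f x :=
    (hf.contDiffAt).isSymmSndFDerivAt (by simp only [minSmoothness_of_isRCLikeNormedField]; exact WithTop.coe_le_coe.2 (le_top : (2 : ℕ∞) ≤ ⊤))
  exact hs _ _

lemma pderivI_iter_smooth {d : ℕ} (i : Fin d) (k : ℕ) {f : Ed d → ℝ}
    (hf : ContDiff ℝ (⊤ : ℕ∞) f) : ContDiff ℝ (⊤ : ℕ∞) ((pderivI d i)^[k] f) := by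
  induction k generalizing f with
  | zero => simpa using hf
  | succ k ih => rw [Function.iterate_succ_apply]; exact ih (pderivI_smooth i hf)

lemma pderivI_iter_comm {d : ℕ} (i j : Fin d) (k : ℕ) {f : Ed d → ℝ}
    (hf : ContDiff ℝ (⊤ : ℕ∞) f) :
    pderivI d i ((pderivI d j)^[k] f) = (pderivI d j)^[k] (pderivI d i f) := by
  induction k generalizing f with
  | zero => simp
  | succ k ih =>
    rw [Function.iterate_succ_apply, Function.iterate_succ_apply, ih (pderivI_smooth j hf),
      pderivI_comm i j hf]

/-- Partial derivative along a list of coordinates. -/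
def pderivL (d : ℕ) (l : List (Fin d)) (α : Fin d → ℕ) (f : Ed d → ℝ) : Ed d → ℝ :=
  (l.foldr (fun i g => (pderivI d i)^[α i] ∘ g) id) f

lemma pderivL_cons {d : ℕ} (j : Fin d) (l : List (Fin d)) (α : Fin d → ℕ) (f : Ed d → ℝ) :
    pderivL d (j :: l) α f = (pderivI d j)^[α j] (pderivL d l α f) := rfl

lemma pderivL_smooth {d : ℕ} (l : List (Fin d)) (α : Fin d → ℕ) {f : Ed d → ℝ}
    (hf : ContDiff ℝ (⊤ : ℕ∞) f) : ContDiff ℝ (⊤ : ℕ∞) (pderivL d l α f) := by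
  induction l with
  | nil => exact hf
  | cons j l ih => rw [pderivL_cons]; exact pderivI_iter_smooth j _ ih

lemma pderivL_comm {d : ℕ} (i : Fin d) (l : List (Fin d)) (α : Fin d → ℕ) {f : Ed d → ℝ}
    (hf : ContDiff ℝ (⊤ : ℕ∞) f) :
    pderivI d i (pderivL d l α f) = pderivL d l α (pderivI d i f) := by
  induction l with
  | nil => rfl
  | cons j l ih =>
    rw [pderivL_cons, pderivL_cons, pderivI_iter_comm i j _ (pderivL_smooth l α hf), ih]

lemma pderivL_add_not_mem {d : ℕ} (i : Fin d) (l : List (Fin d)) (α : Fin d → ℕ)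
    (f : Ed d → ℝ) (hi : i ∉ l) :
    pderivL d l (α + Pi.single i 1) f = pderivL d l α f := by
  induction l with
  | nil => rfl
  | cons j l ih =>
    simp only [List.mem_cons, not_or] at hi
    rw [pderivL_cons, pderivL_cons, ih hi.2]
    have : (α + Pi.single i 1 : Fin d → ℕ) j = α j := by
      simp [Ne.symm hi.1]
    rw [this]

lemma pderivL_add {d : ℕ} (i : Fin d) (l : List (Fin d)) (hl : l.Nodup) (α : Fin d → ℕ)
    {f : Ed d → ℝ} (hf : ContDiff ℝ (⊤ : ℕ∞) f) (hi : i ∈ l) :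
    pderivL d l (α + Pi.single i 1) f = pderivL d l α (pderivI d i f) := by
  induction l with
  | nil => simp at hi
  | cons j l ih =>
    rw [List.nodup_cons] at hl
    rw [pderivL_cons, pderivL_cons]
    rcases eq_or_ne i j with rfl | hij
    · rw [pderivL_add_not_mem i l α f hl.1, ← pderivL_comm i l α hf]
      have : (α + Pi.single i 1 : Fin d → ℕ) i = α i + 1 := by simp
      rw [this, Function.iterate_succ_apply]
    · have hi' : i ∈ l := by simpa [hij] using hi
      have : (α + Pi.single i 1 : Fin d → ℕ) j = α j := by
        simp [Ne.symm hij]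
      rw [this, ih hl.2 hi']

lemma pderivA_add {d : ℕ} (i : Fin d) (α : Fin d → ℕ) {f : Ed d → ℝ}
    (hf : ContDiff ℝ (⊤ : ℕ∞) f) :
    pderivA d (α + Pi.single i 1) f = pderivA d α (pderivI d i f) :=
  pderivL_add i (List.finRange d) (List.nodup_finRange d) α hf (List.mem_finRange i)

lemma pderivA_zero {d : ℕ} (f : Ed d → ℝ) : pderivA d 0 f = f := by
  change pderivL d (List.finRange d) 0 f = f
  induction (List.finRange d) with
  | nil => rfl
  | cons j l ih => rw [pderivL_cons, ih]; rfl

lemma pderivI_test {d : ℕ} {Ω : Set (Ed d)} (i : Fin d) {φ : Ed d → ℝ}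
    (h : IsTestFun d Ω φ) : IsTestFun d Ω (pderivI d i φ) := by
  have hs : tsupport (pderivI d i φ) ⊆ tsupport φ := tsupport_fderiv_apply_subset ℝ _
  refine ⟨pderivI_smooth i h.1, ?_, hs.trans h.2.2⟩
  exact h.2.1.mono' ((subset_tsupport _).trans hs)

lemma IsTestFun.integrable_mul {d : ℕ} {Ω : Set (Ed d)} {φ : Ed d → ℝ}
    (h : IsTestFun d Ω φ) {u : Ed d → ℝ} (hu : LocallyIntegrableOn u Ω volume) :
    Integrable (fun x => u x * φ x) volume := by
  have hK : IsCompact (tsupport φ) := h.2.1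
  have h1 : IntegrableOn u (tsupport φ) volume :=
    hu.integrableOn_compact_subset h.2.2 hK
  have h2 : IntegrableOn (fun x => u x * φ x) (tsupport φ) volume :=
    h1.mul_continuousOn h.1.continuous.continuousOn hK
  rw [← integrableOn_iff_integrable_of_support_subset (s := tsupport φ)]
  · exact h2
  · intro x hx
    apply subset_tsupport
    intro h0
    exact hx (by simp [h0])

lemma setIntegral_eq_of_test {d : ℕ} {Ω : Set (Ed d)} {φ : Ed d → ℝ}
    (h : IsTestFun d Ω φ) (u : Ed d → ℝ) :
    ∫ x in Ω, u x * φ x = ∫ x, u x * φ x := by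
  apply setIntegral_eq_integral_of_forall_compl_eq_zero
  intro x hx
  have : φ x = 0 := by
    by_contra h0
    exact hx (h.2.2 (subset_tsupport _ h0))
  simp [this]

/-! ### First order weak derivatives -/

/-- `g` is the weak derivative of `u` in direction `i` on `Ω`. -/
def HasW (d : ℕ) (Ω : Set (Ed d)) (i : Fin d) (u g : Ed d → ℝ) : Prop :=
  LocallyIntegrableOn u Ω volume ∧ LocallyIntegrableOn g Ω volume ∧
    ∀ φ : Ed d → ℝ, IsTestFun d Ω φ →
      ∫ x, u x * pderivI d i φ x = - ∫ x, g x * φ x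

lemma mem_multiIdx {d m : ℕ} {α : Fin d → ℕ} : α ∈ multiIdx d m ↔ ∑ i, α i ≤ m := by
  unfold multiIdx
  simp only [Finset.mem_filter, Fintype.mem_piFinset, Finset.mem_range, and_iff_right_iff_imp]
  intro h i
  have := Finset.single_le_sum (f := α) (fun _ _ => Nat.zero_le _) (Finset.mem_univ i)
  omega

lemma sum_add_single {d : ℕ} (α : Fin d → ℕ) (i : Fin d) :
    ∑ j, (α + Pi.single i 1 : Fin d → ℕ) j = ∑ j, α j + 1 := by
  simp [Finset.sum_add_distrib]

lemma IsWeakDerivFamily.hasW {d m : ℕ} {Ω : Set (Ed d)} {u : Ed d → ℝ}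
    {D : (Fin d → ℕ) → Ed d → ℝ} (h : IsWeakDerivFamily d Ω m u D) (α : Fin d → ℕ) (i : Fin d)
    (hα : ∑ j, α j + 1 ≤ m) : HasW d Ω i (D α) (D (α + Pi.single i 1)) := by
  have h1 := h α (mem_multiIdx.2 (by omega))
  have h2 := h (α + Pi.single i 1) (mem_multiIdx.2 (by rw [sum_add_single]; exact hα))
  refine ⟨h1.2.1, h2.2.1, fun φ hφ => ?_⟩
  have e1 := h1.2.2 _ (pderivI_test i hφ)
  have e2 := h2.2.2 φ hφ
  rw [pderivA_add i α hφ.1, sum_add_single, e1, setIntegral_eq_of_test (pderivI_test i hφ),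
    setIntegral_eq_of_test hφ, pow_succ, mul_assoc] at e2
  have := mul_left_cancel₀ (pow_ne_zero _ (by norm_num)) e2
  linarith

lemma HasWeakDerivOn.step {d : ℕ} {Ω : Set (Ed d)} {u g h : Ed d → ℝ} {α : Fin d → ℕ} {i : Fin d}
    (h1 : HasWeakDerivOn d Ω α u g) (h2 : HasW d Ω i g h) :
    HasWeakDerivOn d Ω (α + Pi.single i 1) u h := by
  refine ⟨h1.1, h2.2.1, fun φ hφ => ?_⟩
  rw [pderivA_add i α hφ.1, sum_add_single, h1.2.2 _ (pderivI_test i hφ),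
    setIntegral_eq_of_test (pderivI_test i hφ), h2.2.2 φ hφ, setIntegral_eq_of_test hφ, pow_succ]
  ring

lemma HasWeakDerivOn.ae_unique {d : ℕ} {Ω : Set (Ed d)} (hΩ : IsOpen Ω) {u g h : Ed d → ℝ}
    {α : Fin d → ℕ} (h1 : HasWeakDerivOn d Ω α u g) (h2 : HasWeakDerivOn d Ω α u h) :
    ∀ᵐ x, x ∈ Ω → g x = h x := by
  have := hΩ.ae_eq_zero_of_integral_contDiff_smul_eq_zero (μ := volume) (f := g - h)
    (h1.2.1.sub h2.2.1) (fun φ ha hb hc => by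
      have ht : IsTestFun d Ω φ := ⟨ha, hb, hc⟩
      have e1 := h1.2.2 φ ht
      rw [h2.2.2 φ ht, setIntegral_eq_of_test ht, setIntegral_eq_of_test ht] at e1
      have e2 := mul_left_cancel₀ (pow_ne_zero _ (by norm_num)) e1
      have : ∀ x, φ x • (g - h) x = g x * φ x - h x * φ x := by
        intro x; simp; ring
      simp_rw [this]
      rw [integral_sub (ht.integrable_mul h1.2.1) (ht.integrable_mul h2.2.1), e2, sub_self])
  filter_upwards [this] with x hx hxΩ
  have := hx hxΩ
  simpa [sub_eq_zero] using this

lemma HasWeakDerivOn.zero_of_ae {d : ℕ} {Ω : Set (Ed d)} {u g : Ed d → ℝ}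
    (hu : LocallyIntegrableOn u Ω volume) (hg : LocallyIntegrableOn g Ω volume)
    (h : ∀ᵐ x, x ∈ Ω → u x = g x) : HasWeakDerivOn d Ω 0 u g := by
  refine ⟨hu, hg, fun φ hφ => ?_⟩
  rw [pderivA_zero, setIntegral_eq_of_test hφ, setIntegral_eq_of_test hφ]
  simp only [Pi.zero_apply, Finset.sum_const_zero, pow_zero, one_mul]
  apply integral_congr_ae
  filter_upwards [h] with x hx
  by_cases hxΩ : x ∈ Ω
  · rw [hx hxΩ]
  · have : φ x = 0 := by
      by_contra h0
      exact hxΩ (hφ.2.2 (subset_tsupport _ h0))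
    simp [this]

lemma HasWeakDerivOn.ae_eq_zero_index {d : ℕ} {Ω : Set (Ed d)} (hΩ : IsOpen Ω) {u g : Ed d → ℝ}
    (h : HasWeakDerivOn d Ω 0 u g) : ∀ᵐ x, x ∈ Ω → u x = g x :=
  HasWeakDerivOn.ae_unique hΩ
    (HasWeakDerivOn.zero_of_ae h.1 h.1 (Filter.Eventually.of_forall fun _ _ => rfl)) h


/-! ### Mollification -/

open scoped Convolution

/-- A sequence of bump functions shrinking to the origin. -/
def bmp (d : ℕ) (k : ℕ) : ContDiffBump (0 : Ed d) where
  rIn := 1 / (2 * ((k : ℝ) + 1))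
  rOut := 1 / ((k : ℝ) + 1)
  rIn_pos := by positivity
  rIn_lt_rOut := by
    apply one_div_lt_one_div_of_lt <;> nlinarith [(Nat.cast_nonneg k : (0 : ℝ) ≤ k)]

/-- Mollifier kernel. -/
def psi (d k : ℕ) : Ed d → ℝ := (bmp d k).normed volume

/-- Mollification. -/
def mol (d k : ℕ) (g : Ed d → ℝ) : Ed d → ℝ :=
  (psi d k) ⋆[ContinuousLinearMap.lsmul ℝ ℝ, volume] g

lemma psi_smooth (d k : ℕ) : ContDiff ℝ (⊤ : ℕ∞) (psi d k) := (bmp d k).contDiff_normed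

lemma psi_nonneg (d k : ℕ) (x : Ed d) : 0 ≤ psi d k x := (bmp d k).nonneg_normed x

lemma psi_compact (d k : ℕ) : HasCompactSupport (psi d k) := (bmp d k).hasCompactSupport_normed

lemma psi_support (d k : ℕ) : Function.support (psi d k) = ball 0 (1 / ((k : ℝ) + 1)) :=
  (bmp d k).support_normed_eq

lemma psi_lintegral (d k : ℕ) : ∫⁻ x, ENNReal.ofReal (psi d k x) = 1 := by
  have hI : Integrable (psi d k) volume := (bmp d k).integrable_normed
  rw [← ofReal_integral_eq_lintegral_ofReal hI
    (Filter.Eventually.of_forall (psi_nonneg d k))]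
  have : ∫ x, psi d k x = 1 := (bmp d k).integral_normed
  rw [this, ENNReal.ofReal_one]

lemma psi_lintegral_sub (d k : ℕ) (y : Ed d) : ∫⁻ z, ENNReal.ofReal (psi d k (y - z)) = 1 := by
  rw [lintegral_sub_left_eq_self (fun z => ENNReal.ofReal (psi d k z)) y]
  exact psi_lintegral d k

lemma mol_smooth {d : ℕ} (k : ℕ) {g : Ed d → ℝ} (hg : LocallyIntegrable g volume) :
    ContDiff ℝ (⊤ : ℕ∞) (mol d k g) :=
  (psi_compact d k).contDiff_convolution_left _ (psi_smooth d k) hg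

lemma mol_apply {d : ℕ} (k : ℕ) (g : Ed d → ℝ) (x : Ed d) :
    mol d k g x = ∫ y, psi d k (x - y) * g y := by
  unfold mol
  rw [convolution_lsmul_swap]
  rfl

lemma mol_tendsto {d : ℕ} {g : Ed d → ℝ} (hg : LocallyIntegrable g volume) :
    ∀ᵐ x, Tendsto (fun k => mol d k g x) atTop (𝓝 (g x)) := by
  refine ContDiffBump.ae_convolution_tendsto_right_of_locallyIntegrable (φ := bmp d) (K := 2)
    ?_ ?_ hg
  · exact tendsto_one_div_add_atTop_nhds_zero_nat
  · refine Filter.Eventually.of_forall fun k => ?_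
    change 1 / ((k : ℝ) + 1) ≤ 2 * (1 / (2 * ((k : ℝ) + 1)))
    have : (0 : ℝ) < (k : ℝ) + 1 := by positivity
    apply le_of_eq
    field_simp

lemma enorm_mol_le {d : ℕ} (k : ℕ) (g : Ed d → ℝ) (x : Ed d) :
    ‖mol d k g x‖ₑ ≤ ∫⁻ z, ENNReal.ofReal (psi d k (x - z)) * ‖g z‖ₑ := by
  rw [mol_apply]
  refine (enorm_integral_le_lintegral_enorm _).trans (le_of_eq ?_)
  congr 1
  funext z
  rw [enorm_mul, Real.enorm_eq_ofReal (psi_nonneg d k _)]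

lemma mol_bound {d : ℕ} (k : ℕ) {g : Ed d → ℝ} {C : ℝ} (hC : 0 ≤ C) (hg : ∀ᵐ x, |g x| ≤ C)
    (x : Ed d) : |mol d k g x| ≤ C := by
  have h1 : ‖mol d k g x‖ₑ ≤ ENNReal.ofReal C := by
    refine (enorm_mol_le k g x).trans ?_
    calc ∫⁻ z, ENNReal.ofReal (psi d k (x - z)) * ‖g z‖ₑ
        ≤ ∫⁻ z, ENNReal.ofReal (psi d k (x - z)) * ENNReal.ofReal C := by
          apply lintegral_mono_ae
          filter_upwards [hg] with z hz
          gcongr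
          rw [Real.enorm_eq_ofReal_abs]
          exact ENNReal.ofReal_le_ofReal hz
      _ = ENNReal.ofReal C := by
          rw [lintegral_mul_const' _ _ ENNReal.ofReal_ne_top, psi_lintegral_sub, one_mul]
  rw [Real.enorm_eq_ofReal_abs] at h1
  exact (ENNReal.ofReal_le_ofReal_iff hC).1 h1

/-- Hölder / Jensen inequality for lower integrals on a finite measure. -/
lemma lintegral_le_Lp {α : Type*} [MeasurableSpace α] (μ : Measure α) {p : ℝ} (hp : 1 ≤ p)
    {f : α → ℝ≥0∞} (hf : AEMeasurable f μ) :
    ∫⁻ x, f x ∂μ ≤ (∫⁻ x, f x ^ p ∂μ) ^ (1 / p) * μ univ ^ (1 - 1 / p) := by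
  have := eLpNorm'_le_eLpNorm'_mul_rpow_measure_univ (p := 1) (q := p) (μ := μ) (f := f)
    one_pos hp hf.aestronglyMeasurable
  simpa [eLpNorm'] using this

lemma mol_Lp {d : ℕ} (k : ℕ) {g : Ed d → ℝ} (hg : AEStronglyMeasurable g volume) {p : ℝ}
    (hp : 1 ≤ p) (x : Ed d) (r : ℝ) :
    ∫⁻ y in ball x r, ‖mol d k g y‖ₑ ^ p ≤
      ∫⁻ z in ball x (r + 1 / ((k : ℝ) + 1)), ‖g z‖ₑ ^ p := by
  have hp0 : 0 < p := by linarith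
  have hm : ∀ y : Ed d, Measurable fun z => ENNReal.ofReal (psi d k (y - z)) := fun y =>
    ((psi_smooth d k).continuous.comp (continuous_const.sub continuous_id)).measurable.ennreal_ofReal
  have h1 : ∀ y, ‖mol d k g y‖ₑ ^ p ≤
      ∫⁻ z, ENNReal.ofReal (psi d k (y - z)) * ‖g z‖ₑ ^ p := by
    intro y
    set ν := (volume : Measure (Ed d)).withDensity (fun z => ENNReal.ofReal (psi d k (y - z)))
      with hν
    have hac : ν ≪ volume := withDensity_absolutelyContinuous _ _
    have hu : ν univ = 1 := by
      rw [hν, withDensity_apply _ MeasurableSet.univ, Measure.restrict_univ, psi_lintegral_sub]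
    have h2 := lintegral_le_Lp ν hp (f := fun z => ‖g z‖ₑ) (hg.enorm.mono_ac hac)
    rw [hu, ENNReal.one_rpow, mul_one] at h2
    have h3 : ‖mol d k g y‖ₑ ≤ ∫⁻ z, ‖g z‖ₑ ∂ν := by
      refine (enorm_mol_le k g y).trans (le_of_eq ?_)
      rw [hν, lintegral_withDensity_eq_lintegral_mul₀ (hm y).aemeasurable hg.enorm]
      rfl
    have h4 : ∫⁻ z, ‖g z‖ₑ ^ p ∂ν = ∫⁻ z, ENNReal.ofReal (psi d k (y - z)) * ‖g z‖ₑ ^ p := by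
      rw [hν, lintegral_withDensity_eq_lintegral_mul₀ (hm y).aemeasurable (hg.enorm.pow_const p)]
      rfl
    rw [← h4]
    calc ‖mol d k g y‖ₑ ^ p ≤ ((∫⁻ z, ‖g z‖ₑ ^ p ∂ν) ^ (1 / p)) ^ p := by
          gcongr; exact h3.trans h2
      _ = _ := by rw [← ENNReal.rpow_mul, one_div_mul_cancel hp0.ne', ENNReal.rpow_one]
  calc ∫⁻ y in ball x r, ‖mol d k g y‖ₑ ^ p
      ≤ ∫⁻ y in ball x r, ∫⁻ z, ENNReal.ofReal (psi d k (y - z)) * ‖g z‖ₑ ^ p :=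
        lintegral_mono h1
    _ = ∫⁻ z, ∫⁻ y in ball x r, ENNReal.ofReal (psi d k (y - z)) * ‖g z‖ₑ ^ p := by
        apply lintegral_lintegral_swap
        apply AEMeasurable.mul
        · exact ((psi_smooth d k).continuous.comp
            (continuous_fst.sub continuous_snd)).measurable.ennreal_ofReal.aemeasurable
        · exact (hg.enorm.pow_const p).comp_snd
    _ ≤ ∫⁻ z, (ball x (r + 1 / ((k : ℝ) + 1))).indicator (fun z => ‖g z‖ₑ ^ p) z := by
        apply lintegral_mono
        intro z
        dsimp only
        have hmz : Measurable fun y => ENNReal.ofReal (psi d k (y - z)) :=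
          ((psi_smooth d k).continuous.comp
            (continuous_id.sub continuous_const)).measurable.ennreal_ofReal
        rw [lintegral_mul_const _ hmz]
        by_cases hz : z ∈ ball x (r + 1 / ((k : ℝ) + 1))
        · rw [indicator_of_mem hz]
          calc _ ≤ (∫⁻ y, ENNReal.ofReal (psi d k (y - z))) * ‖g z‖ₑ ^ p := by
                gcongr; exact Measure.restrict_le_self
            _ = _ := by
                rw [lintegral_sub_right_eq_self (fun y => ENNReal.ofReal (psi d k y)) z,
                  psi_lintegral, one_mul]
        · rw [indicator_of_notMem hz]
          have : ∫⁻ y in ball x r, ENNReal.ofReal (psi d k (y - z)) = 0 := by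
            rw [setLIntegral_eq_zero_iff measurableSet_ball hmz]
            refine Filter.Eventually.of_forall fun y hy => ?_
            have : psi d k (y - z) = 0 := by
              by_contra h0
              have h5 : y - z ∈ Function.support (psi d k) := h0
              rw [psi_support, mem_ball_zero_iff, ← dist_eq_norm] at h5
              apply hz
              rw [mem_ball] at hy ⊢
              have := dist_triangle z y x
              rw [dist_comm z y] at this
              linarith
            simp [this]
          rw [this, zero_mul]
    _ = _ := lintegral_indicator measurableSet_ball _

lemma indicator_locInt {d : ℕ} {Ω K : Set (Ed d)} {u : Ed d → ℝ}
    (hu : LocallyIntegrableOn u Ω volume) (hK : IsCompact K) (hKΩ : K ⊆ Ω) :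
    LocallyIntegrable (K.indicator u) volume :=
  ((hu.integrableOn_compact_subset hKΩ hK).integrable_indicator hK.measurableSet).locallyIntegrable

lemma mol_pderivI {d : ℕ} {Ω K : Set (Ed d)} {i : Fin d} {w g : Ed d → ℝ} (h : HasW d Ω i w g)
    (hK : IsCompact K) (hKΩ : K ⊆ Ω) (k : ℕ) {x : Ed d}
    (hx : closedBall x (1 / ((k : ℝ) + 1)) ⊆ K) :
    pderivI d i (mol d k (K.indicator w)) x = mol d k (K.indicator g) x := by
  have hW := indicator_locInt h.1 hK hKΩ
  set φ : Ed d → ℝ := fun y => psi d k (x - y) with hφ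
  have hφ0 : ∀ y, y ∉ K → φ y = 0 := by
    intro y hy
    by_contra h0
    have h5 : x - y ∈ Function.support (psi d k) := h0
    rw [psi_support, mem_ball_zero_iff, ← dist_eq_norm] at h5
    exact hy (hx (by rw [mem_closedBall, dist_comm]; exact h5.le))
  have hφs : tsupport φ ⊆ K := by
    apply closure_minimal _ hK.isClosed
    intro y hy
    by_contra h0
    exact hy (hφ0 y h0)
  have ht : IsTestFun d Ω φ := by
    refine ⟨(psi_smooth d k).comp (contDiff_const.sub contDiff_id), ?_, hφs.trans hKΩ⟩
    exact hK.of_isClosed_subset (isClosed_tsupport _) hφs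
  have hpd : ∀ y, pderivI d i φ y = - pderivI d i (psi d k) (x - y) := by
    intro y
    unfold pderivI
    have h1 : HasFDerivAt (psi d k) (fderiv ℝ (psi d k) (x - y)) (x - y) :=
      (((psi_smooth d k).differentiable (by simp)) (x - y)).hasFDerivAt
    have h2 : HasFDerivAt (fun y : Ed d => x - y) (-ContinuousLinearMap.id ℝ (Ed d)) y :=
      (hasFDerivAt_id y).const_sub x
    have h3 := (h1.comp y h2).fderiv
    rw [show φ = psi d k ∘ (fun y : Ed d => x - y) from rfl, h3]
    simp
  have hpd0 : ∀ y, y ∉ K → pderivI d i φ y = 0 := by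
    intro y hy
    by_contra h0
    exact hy (hφs ((tsupport_fderiv_apply_subset ℝ _) (subset_tsupport _ h0)))
  have key := h.2.2 φ ht
  have e1 : mol d k (K.indicator g) x = ∫ y, g y * φ y := by
    rw [mol_apply]
    congr 1
    funext y
    by_cases hy : y ∈ K
    · rw [indicator_of_mem hy]; ring
    · have := hφ0 y hy
      rw [indicator_of_notMem hy, this]; ring
  have hder := (psi_compact d k).hasFDerivAt_convolution_left
    (ContinuousLinearMap.lsmul ℝ ℝ) ((psi_smooth d k).of_le (by simp)) hW x
  have hc : HasCompactSupport (fderiv ℝ (psi d k)) := (psi_compact d k).fderiv ℝ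
  have hcc : Continuous (fderiv ℝ (psi d k)) := (psi_smooth d k).continuous_fderiv (by simp)
  have hex := (hc.convolutionExists_left (μ := volume) (ContinuousLinearMap.precompL (Ed d)
        (ContinuousLinearMap.lsmul ℝ ℝ : ℝ →L[ℝ] ℝ →L[ℝ] ℝ)) hcc hW x).integrable_swap
  have e2 : pderivI d i (mol d k (K.indicator w)) x =
      ∫ y, pderivI d i (psi d k) (x - y) * (K.indicator w) y := by
    unfold pderivI mol
    rw [hder.fderiv, convolution_eq_swap]
    exact ContinuousLinearMap.integral_apply hex (EuclideanSpace.single i 1)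
  rw [e1, e2]
  rw [← neg_eq_iff_eq_neg] at key
  rw [← key, ← integral_neg]
  congr 1
  funext y
  by_cases hy : y ∈ K
  · rw [indicator_of_mem hy, hpd]; ring
  · rw [indicator_of_notMem hy, hpd0 y hy]; ring


/-! ### The product rule -/

/-- Local essential boundedness. -/
def LocBdd (d : ℕ) (Ω : Set (Ed d)) (b : Ed d → ℝ) : Prop :=
  ∀ K : Set (Ed d), IsCompact K → K ⊆ Ω → ∃ C : ℝ, 0 ≤ C ∧ ∀ᵐ x, x ∈ K → |b x| ≤ C

lemma locInt_mul {d : ℕ} {Ω : Set (Ed d)} (hΩ : IsOpen Ω) {b u : Ed d → ℝ}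
    (hb : LocallyIntegrableOn b Ω volume) (hbb : LocBdd d Ω b)
    (hu : LocallyIntegrableOn u Ω volume) :
    LocallyIntegrableOn (fun x => b x * u x) Ω volume := by
  rw [locallyIntegrableOn_iff hΩ.isLocallyClosed]
  intro K hKΩ hK
  obtain ⟨C, hC, hbC⟩ := hbb K hK hKΩ
  have h1 : IntegrableOn u K volume := hu.integrableOn_compact_subset hKΩ hK
  have h2 : IntegrableOn b K volume := hb.integrableOn_compact_subset hKΩ hK
  refine Integrable.bdd_mul (c := C) h1 h2.aestronglyMeasurable ?_
  rw [ae_restrict_iff' hK.measurableSet]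
  exact hbC

lemma tendsto_mol_mul {d : ℕ} {Ω K : Set (Ed d)} {b f φ : Ed d → ℝ}
    (hK : IsCompact K) (hKΩ : K ⊆ Ω)
    (hb : LocallyIntegrableOn b Ω volume) (hbb : LocBdd d Ω b)
    (hf : LocallyIntegrableOn f Ω volume) (hφ : IsTestFun d Ω φ) (hφK : tsupport φ ⊆ K) :
    (∀ k, Integrable (fun x => f x * (mol d k (K.indicator b) x * φ x))) ∧
    Tendsto (fun k => ∫ x, f x * (mol d k (K.indicator b) x * φ x)) atTop
      (𝓝 (∫ x, f x * (b x * φ x))) := by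
  obtain ⟨C, hC, hbC⟩ := hbb K hK hKΩ
  have hbl := indicator_locInt hb hK hKΩ
  have hintgr := hφ.integrable_mul hf
  have hbd : ∀ k x, |mol d k (K.indicator b) x| ≤ C := by
    intro k x
    apply mol_bound k hC
    filter_upwards [hbC] with y hy
    by_cases hyK : y ∈ K
    · rw [indicator_of_mem hyK]; exact hy hyK
    · rw [indicator_of_notMem hyK]; simpa using hC
  have hfk : ∀ k, Integrable (fun x => f x * (mol d k (K.indicator b) x * φ x)) := by
    intro k
    have := hintgr.bdd_mul (c := C) (f := mol d k (K.indicator b))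
      (mol_smooth k hbl).continuous.aestronglyMeasurable
      (Filter.Eventually.of_forall (fun x => hbd k x))
    refine this.congr (Filter.Eventually.of_forall fun x => ?_)
    simp only
    ring
  refine ⟨hfk, ?_⟩
  refine tendsto_integral_of_dominated_convergence (fun x => C * ‖f x * φ x‖)
    (fun k => (hfk k).aestronglyMeasurable) (hintgr.norm.const_mul C) ?_ ?_
  · intro k
    refine Filter.Eventually.of_forall fun x => ?_
    rw [show f x * (mol d k (K.indicator b) x * φ x) =
      mol d k (K.indicator b) x * (f x * φ x) by ring, norm_mul]
    gcongr
    exact hbd k x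
  · filter_upwards [mol_tendsto hbl] with x hx
    by_cases hxK : x ∈ K
    · rw [indicator_of_mem hxK] at hx
      exact (hx.mul_const _).const_mul _
    · have : φ x = 0 := by
        by_contra h0
        exact hxK (hφK (subset_tsupport _ h0))
      simp [this]

lemma pderivI_mul {d : ℕ} (i : Fin d) {f g : Ed d → ℝ} (hf : ContDiff ℝ (⊤ : ℕ∞) f)
    (hg : ContDiff ℝ (⊤ : ℕ∞) g) (x : Ed d) :
    pderivI d i (fun y => f y * g y) x = pderivI d i f x * g x + f x * pderivI d i g x := by
  unfold pderivI
  rw [fderiv_fun_mul ((hf.differentiable (by simp)) x) ((hg.differentiable (by simp)) x)]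
  simp
  ring

lemma HasW.mul {d : ℕ} {Ω : Set (Ed d)} (hΩ : IsOpen Ω) {i : Fin d} {u u' v v' : Ed d → ℝ}
    (hu : HasW d Ω i u u') (hv : HasW d Ω i v v') (hb : LocBdd d Ω v) (hb' : LocBdd d Ω v') :
    HasW d Ω i (fun x => v x * u x) (fun x => v' x * u x + v x * u' x) := by
  refine ⟨locInt_mul hΩ hv.1 hb hu.1,
    (locInt_mul hΩ hv.2.1 hb' hu.1).add (locInt_mul hΩ hv.1 hb hu.2.1), fun φ hφ => ?_⟩
  have hS : IsCompact (tsupport φ) := hφ.2.1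
  obtain ⟨δ, hδ, hδΩ⟩ := hS.exists_cthickening_subset_open hΩ hφ.2.2
  set K := cthickening δ (tsupport φ) with hKdef
  have hK : IsCompact K := hS.cthickening
  have hφK : tsupport φ ⊆ K := self_subset_cthickening _
  have hdφ := pderivI_test i hφ
  have hdφK : tsupport (pderivI d i φ) ⊆ K :=
    (tsupport_fderiv_apply_subset ℝ _).trans hφK
  obtain ⟨i1, t1⟩ := tendsto_mol_mul hK hδΩ hv.2.1 hb' hu.1 hφ hφK
  obtain ⟨i2, t2⟩ := tendsto_mol_mul hK hδΩ hv.1 hb hu.1 hdφ hdφK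
  obtain ⟨i3, t3⟩ := tendsto_mol_mul hK hδΩ hv.1 hb hu.2.1 hφ hφK
  have hev : ∀ᶠ k : ℕ in atTop,
      (∫ x, u x * (mol d k (K.indicator v') x * φ x)) +
        (∫ x, u x * (mol d k (K.indicator v) x * pderivI d i φ x)) =
      - ∫ x, u' x * (mol d k (K.indicator v) x * φ x) := by
    have h0 : ∀ᶠ k : ℕ in atTop, 1 / ((k : ℝ) + 1) < δ :=
      (tendsto_one_div_add_atTop_nhds_zero_nat (𝕜 := ℝ)).eventually (gt_mem_nhds hδ)
    filter_upwards [h0] with k hk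
    have hsm := mol_smooth k (indicator_locInt hv.1 hK hδΩ)
    have ht : IsTestFun d Ω (fun x => mol d k (K.indicator v) x * φ x) := by
      have hs : tsupport (fun x => mol d k (K.indicator v) x * φ x) ⊆ tsupport φ :=
        tsupport_mul_subset_right
      exact ⟨hsm.mul hφ.1, hS.of_isClosed_subset (isClosed_tsupport _) hs, hs.trans hφ.2.2⟩
    have e := hu.2.2 _ ht
    rw [← e, ← integral_add (i1 k) (i2 k)]
    congr 1
    funext x
    rw [pderivI_mul i hsm hφ.1]
    by_cases hx : φ x = 0
    · rw [hx]; ring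
    · rw [mol_pderivI hv hK hδΩ k]
      · ring
      · have hxS : x ∈ tsupport φ := subset_tsupport _ hx
        exact (closedBall_subset_closedBall hk.le).trans (closedBall_subset_cthickening hxS δ)
  have hlim := tendsto_nhds_unique ((t1.add t2).congr' hev) t3.neg
  have j1 := hφ.integrable_mul (locInt_mul hΩ hv.2.1 hb' hu.1)
  have j2 := hφ.integrable_mul (locInt_mul hΩ hv.1 hb hu.2.1)
  have s1 : ∫ x, (v' x * u x + v x * u' x) * φ x =
      (∫ x, u x * (v' x * φ x)) + ∫ x, u' x * (v x * φ x) := by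
    rw [← integral_add]
    · congr 1; funext x; ring
    · refine j1.congr (Filter.Eventually.of_forall fun x => ?_)
      simp only; ring
    · refine j2.congr (Filter.Eventually.of_forall fun x => ?_)
      simp only; ring
  have s2 : ∫ x, v x * u x * pderivI d i φ x = ∫ x, u x * (v x * pderivI d i φ x) := by
    congr 1; funext x; ring
  rw [s1, s2]
  linarith

lemma HasW.add {d : ℕ} {Ω : Set (Ed d)} {i : Fin d} {u u' v v' : Ed d → ℝ}
    (hu : HasW d Ω i u u') (hv : HasW d Ω i v v') :
    HasW d Ω i (fun x => u x + v x) (fun x => u' x + v' x) := by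
  refine ⟨hu.1.add hv.1, hu.2.1.add hv.2.1, fun φ hφ => ?_⟩
  have hd := pderivI_test i hφ
  simp_rw [add_mul]
  rw [integral_add (hd.integrable_mul hu.1) (hd.integrable_mul hv.1),
    integral_add (hφ.integrable_mul hu.2.1) (hφ.integrable_mul hv.2.1), hu.2.2 φ hφ, hv.2.2 φ hφ]
  ring

lemma HasW.zero {d : ℕ} {Ω : Set (Ed d)} {i : Fin d} :
    HasW d Ω i (fun _ => 0) (fun _ => 0) := by
  refine ⟨locallyIntegrableOn_const 0, locallyIntegrableOn_const 0, fun φ _ => by simp⟩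

/-! ### Leibniz sums -/

/-- The Leibniz sum attached to a list of pairs of multi-indices. -/
def leib {d : ℕ} (Dv Du : (Fin d → ℕ) → Ed d → ℝ) (L : List ((Fin d → ℕ) × (Fin d → ℕ))) :
    Ed d → ℝ :=
  fun x => (L.map fun q => Dv q.1 x * Du q.2 x).sum

/-- Differentiation of Leibniz lists. -/
def leibStep {d : ℕ} (i : Fin d) (L : List ((Fin d → ℕ) × (Fin d → ℕ))) :
    List ((Fin d → ℕ) × (Fin d → ℕ)) :=
  L.flatMap fun q => [(q.1 + Pi.single i 1, q.2), (q.1, q.2 + Pi.single i 1)]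

lemma leib_cons {d : ℕ} (Dv Du : (Fin d → ℕ) → Ed d → ℝ) (q) (L) :
    leib Dv Du (q :: L) = fun x => Dv q.1 x * Du q.2 x + leib Dv Du L x := by
  funext x; simp [leib]

lemma leib_hasW {d m : ℕ} {Ω : Set (Ed d)} (hΩ : IsOpen Ω) {Dv Du : (Fin d → ℕ) → Ed d → ℝ}
    (hv : ∀ α : Fin d → ℕ, ∀ i, ∑ j, α j + 1 ≤ m → HasW d Ω i (Dv α) (Dv (α + Pi.single i 1)))
    (hu : ∀ α : Fin d → ℕ, ∀ i, ∑ j, α j + 1 ≤ m → HasW d Ω i (Du α) (Du (α + Pi.single i 1)))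
    (hb : ∀ α : Fin d → ℕ, ∑ j, α j ≤ m → LocBdd d Ω (Dv α)) (i : Fin d)
    (L : List ((Fin d → ℕ) × (Fin d → ℕ)))
    (hL : ∀ q ∈ L, ∑ j, q.1 j + ∑ j, q.2 j + 1 ≤ m) :
    HasW d Ω i (leib Dv Du L) (leib Dv Du (leibStep i L)) := by
  induction L with
  | nil => exact HasW.zero
  | cons q L ih =>
    have hq := hL q (by simp)
    have h1 := (hu q.2 i (by omega)).mul hΩ (hv q.1 i (by omega)) (hb q.1 (by omega))
      (hb (q.1 + Pi.single i 1) (by rw [sum_add_single]; omega))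
    have h2 := h1.add (ih (fun q' hq' => hL q' (by simp [hq'])))
    rw [leib_cons]
    have e : leib Dv Du (leibStep i (q :: L)) = fun x =>
        (Dv (q.1 + Pi.single i 1) x * Du q.2 x + Dv q.1 x * Du (q.2 + Pi.single i 1) x) +
          leib Dv Du (leibStep i L) x := by
      funext x
      simp [leib, leibStep]
      ring
    rw [e]
    exact h2

/-- For every multi-index there is a Leibniz list, independent of the functions. -/
lemma exists_leib {d : ℕ} (N : ℕ) : ∀ α : Fin d → ℕ, ∑ j, α j = N →
    ∃ L : List ((Fin d → ℕ) × (Fin d → ℕ)),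
      (∀ q ∈ L, ∑ j, q.1 j + ∑ j, q.2 j = N) ∧
      ∀ (m : ℕ) (Ω : Set (Ed d)), IsOpen Ω → ∀ (Dv Du : (Fin d → ℕ) → Ed d → ℝ) (w : Ed d → ℝ),
        N ≤ m →
        (∀ α : Fin d → ℕ, ∀ i, ∑ j, α j + 1 ≤ m → HasW d Ω i (Dv α) (Dv (α + Pi.single i 1))) →
        (∀ α : Fin d → ℕ, ∀ i, ∑ j, α j + 1 ≤ m → HasW d Ω i (Du α) (Du (α + Pi.single i 1))) →
        (∀ α : Fin d → ℕ, ∑ j, α j ≤ m → LocBdd d Ω (Dv α)) →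
        HasWeakDerivOn d Ω 0 w (fun x => Dv 0 x * Du 0 x) →
        HasWeakDerivOn d Ω α w (leib Dv Du L) := by
  induction N with
  | zero =>
    intro α hα
    have h0 : α = 0 := by
      funext j
      simpa using (Finset.sum_eq_zero_iff.1 hα) j (Finset.mem_univ j)
    subst h0
    refine ⟨[(0, 0)], by simp, ?_⟩
    intro m Ω hΩ Dv Du w _ _ _ _ h
    have e : leib Dv Du [(0, 0)] = fun x => Dv 0 x * Du 0 x := by
      funext x; simp [leib]
    rw [e]
    exact h
  | succ N ih =>
    intro α hα
    obtain ⟨i, hi⟩ : ∃ i, α i ≠ 0 := by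
      by_contra hcon
      push Not at hcon
      simp [hcon] at hα
    obtain ⟨α', rfl⟩ : ∃ α' : Fin d → ℕ, α = α' + Pi.single i 1 := by
      refine ⟨α - Pi.single i 1, ?_⟩
      funext j
      by_cases hj : j = i
      · subst hj; simp; omega
      · simp [hj]
    rw [sum_add_single] at hα
    obtain ⟨L, hL1, hL2⟩ := ih α' (by omega)
    refine ⟨leibStep i L, ?_, ?_⟩
    · intro q hq
      simp only [leibStep, List.mem_flatMap, List.mem_cons, List.not_mem_nil, or_false] at hq
      obtain ⟨q', hq', rfl | rfl⟩ := hq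
      · have := hL1 q' hq'
        rw [sum_add_single]; simp only; omega
      · have := hL1 q' hq'
        rw [sum_add_single]; simp only; omega
    · intro m Ω hΩ Dv Du w hNm hv hu hb h0
      exact (hL2 m Ω hΩ Dv Du w (by omega) hv hu hb h0).step
        (leib_hasW hΩ hv hu hb i L (fun q hq => by rw [hL1 q hq]; exact hNm))


/-! ### A Taylor estimate in one variable -/

lemma taylor_hasDeriv (h : ℕ → ℝ → ℝ) (N : ℕ) (t : ℝ)
    (hd : ∀ k, k ≤ N → HasDerivAt (h k) (h (k + 1) t) t) :
    HasDerivAt (fun s => ∑ k ∈ Finset.range (N + 1), (-s) ^ k / (k.factorial : ℝ) * h k s)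
      ((-t) ^ N / (N.factorial : ℝ) * h (N + 1) t) t := by
  induction N with
  | zero => simpa using hd 0 le_rfl
  | succ N ih =>
    have h1 := ih (fun k hk => hd k (by omega))
    have h2 : HasDerivAt (fun s : ℝ => (-s) ^ (N + 1) / ((N + 1).factorial : ℝ))
        (((N + 1 : ℕ) * (-t) ^ N * (-1)) / ((N + 1).factorial : ℝ)) t := by
      have := ((hasDerivAt_neg t).pow (N + 1)).div_const ((N + 1).factorial : ℝ)
      simpa using this
    have h3 := h1.add (h2.mul (hd (N + 1) le_rfl))
    have e : (fun s => ∑ k ∈ Finset.range (N + 1 + 1), (-s) ^ k / (k.factorial : ℝ) * h k s) =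
        (fun s => ∑ k ∈ Finset.range (N + 1), (-s) ^ k / (k.factorial : ℝ) * h k s) +
          ((fun s : ℝ => (-s) ^ (N + 1) / ((N + 1).factorial : ℝ)) * h (N + 1)) := by
      funext s
      simp [Finset.sum_range_succ]
    rw [e]
    refine h3.congr_deriv ?_
    rw [Nat.factorial_succ]
    have hf : (N.factorial : ℝ) ≠ 0 := by positivity
    have hN : ((N + 1 : ℕ) : ℝ) ≠ 0 := by positivity
    push_cast at hN ⊢
    field_simp
    ring

lemma taylor_bound (h : ℕ → ℝ → ℝ) (N : ℕ)
    (hd : ∀ k, k ≤ N → ∀ t ∈ Icc (0 : ℝ) 1, HasDerivAt (h k) (h (k + 1) t) t)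
    (hc : ContinuousOn (h (N + 1)) (Icc 0 1)) :
    ‖h 0 0‖ₑ ≤ (∑ k ∈ Finset.range (N + 1), ‖h k 1‖ₑ) +
      ∫⁻ t in Ioc (0 : ℝ) 1, ENNReal.ofReal (t ^ N) * ‖h (N + 1) t‖ₑ := by
  set G : ℝ → ℝ := fun s => ∑ k ∈ Finset.range (N + 1), (-s) ^ k / (k.factorial : ℝ) * h k s
    with hG
  set G' : ℝ → ℝ := fun t => (-t) ^ N / (N.factorial : ℝ) * h (N + 1) t with hG'
  have hderiv : ∀ t ∈ uIcc (0 : ℝ) 1, HasDerivAt G (G' t) t := by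
    intro t ht
    rw [uIcc_of_le zero_le_one] at ht
    exact taylor_hasDeriv h N t (fun k hk => hd k hk t ht)
  have hintgr : IntervalIntegrable G' volume 0 1 := by
    apply ContinuousOn.intervalIntegrable
    rw [uIcc_of_le zero_le_one]
    exact ContinuousOn.mul (by fun_prop) hc
  have e := intervalIntegral.integral_eq_sub_of_hasDerivAt hderiv hintgr
  have hG0 : G 0 = h 0 0 := by
    rw [hG]
    simp only
    rw [Finset.sum_range_succ']
    simp
  rw [intervalIntegral.integral_of_le zero_le_one, hG0] at e
  have e2 : h 0 0 = G 1 - ∫ t in Ioc (0 : ℝ) 1, G' t := by linarith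
  rw [e2]
  refine (enorm_sub_le).trans ?_
  have hfac : ∀ k : ℕ, (1 : ℝ) ≤ (k.factorial : ℝ) := fun k => by
    exact_mod_cast Nat.factorial_pos k
  gcongr
  · rw [hG]
    simp only
    refine (enorm_sum_le _ _).trans ?_
    apply Finset.sum_le_sum
    intro k _
    rw [enorm_mul]
    calc _ ≤ 1 * ‖h k 1‖ₑ := by
          gcongr
          rw [Real.enorm_eq_ofReal_abs, abs_div, abs_pow, abs_neg, abs_one, one_pow,
            abs_of_pos (by linarith [hfac k])]
          rw [ENNReal.ofReal_le_one]
          exact div_le_one_of_le₀ (hfac k) (by linarith [hfac k])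
      _ = _ := one_mul _
  · refine (enorm_integral_le_lintegral_enorm _).trans ?_
    apply setLIntegral_mono' measurableSet_Ioc
    intro t ht
    rw [hG', enorm_mul]
    gcongr
    rw [Real.enorm_eq_ofReal_abs, abs_div, abs_pow, abs_neg, abs_of_pos ht.1,
      abs_of_pos (by linarith [hfac N])]
    apply ENNReal.ofReal_le_ofReal
    exact div_le_self (pow_nonneg ht.1.le _) (hfac N)

/-! ### Directional derivatives of a family of functions -/

/-- Iterated directional derivatives along the ray `t ↦ x + t y`. -/
def dirH {d : ℕ} (F : (Fin d → ℕ) → Ed d → ℝ) (x y : Ed d) : ℕ → (Fin d → ℕ) → ℝ → ℝ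
  | 0, γ, t => F γ (x + t • y)
  | k + 1, γ, t => ∑ i, y i * dirH F x y k (γ + Pi.single i 1) t

lemma dirH_cont {d : ℕ} {F : (Fin d → ℕ) → Ed d → ℝ} (hF : ∀ γ, ContDiff ℝ (⊤ : ℕ∞) (F γ))
    (x y : Ed d) (k : ℕ) (γ : Fin d → ℕ) : Continuous (dirH F x y k γ) := by
  induction k generalizing γ with
  | zero =>
    have := (hF γ).continuous
    change Continuous fun t : ℝ => F γ (x + t • y)
    fun_prop
  | succ k ih =>
    change Continuous fun t : ℝ => ∑ i, y i * dirH F x y k (γ + Pi.single i 1) t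
    exact continuous_finsetSum _ fun i _ => continuous_const.mul (ih _)

lemma dirH_hasDeriv {d n : ℕ} {F : (Fin d → ℕ) → Ed d → ℝ}
    (hF : ∀ γ, ContDiff ℝ (⊤ : ℕ∞) (F γ)) (x y : Ed d) (t : ℝ)
    (hp : ∀ γ : Fin d → ℕ, ∑ j, γ j < n → ∀ i,
      pderivI d i (F γ) (x + t • y) = F (γ + Pi.single i 1) (x + t • y))
    (k : ℕ) (γ : Fin d → ℕ) (hk : ∑ j, γ j + k < n) :
    HasDerivAt (dirH F x y k γ) (dirH F x y (k + 1) γ t) t := by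
  induction k generalizing γ with
  | zero =>
    have h1 : HasFDerivAt (F γ) (fderiv ℝ (F γ) (x + t • y)) (x + t • y) :=
      (((hF γ).differentiable (by simp)) _).hasFDerivAt
    have h2 : HasDerivAt (fun s : ℝ => x + s • y) y t := by
      simpa using ((hasDerivAt_id t).smul_const y).const_add x
    have h3 := h1.comp_hasDerivAt t h2
    refine h3.congr_deriv ?_
    have hy : y = ∑ i, y i • (EuclideanSpace.single i (1 : ℝ) : Ed d) := by
      ext j
      simp [Finset.sum_apply, Pi.single_apply]
    change _ = ∑ i, y i * F (γ + Pi.single i 1) (x + t • y)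
    conv_lhs => rw [hy]
    rw [map_sum]
    apply Finset.sum_congr rfl
    intro i _
    rw [map_smul, smul_eq_mul, ← hp γ (by omega) i, ← hy]
    rfl
  | succ k ih =>
    change HasDerivAt (fun t : ℝ => ∑ i, y i * dirH F x y k (γ + Pi.single i 1) t)
      (∑ i, y i * dirH F x y (k + 1) (γ + Pi.single i 1) t) t
    apply HasDerivAt.fun_sum
    intro i _
    exact (ih (γ + Pi.single i 1) (by rw [sum_add_single]; omega)).const_mul _

/-- Weighted sum of all derivatives. -/
def totT {d : ℕ} (n : ℕ) (F : (Fin d → ℕ) → Ed d → ℝ) (r : ℝ) (y : Ed d) : ℝ≥0∞ :=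
  ∑ γ ∈ multiIdx d n, ENNReal.ofReal r ^ (∑ j, γ j) * ‖F γ y‖ₑ

lemma dirH_bound {d n : ℕ} (F : (Fin d → ℕ) → Ed d → ℝ) (x y : Ed d) (t r : ℝ)
    (hy : ‖y‖ ≤ r) (k : ℕ) (γ : Fin d → ℕ) (hk : ∑ j, γ j + k ≤ n) :
    ENNReal.ofReal r ^ (∑ j, γ j) * ‖dirH F x y k γ t‖ₑ ≤
      (d : ℝ≥0∞) ^ k * totT n F r (x + t • y) := by
  induction k generalizing γ with
  | zero =>
    rw [pow_zero, one_mul]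
    exact Finset.single_le_sum
      (f := fun γ : Fin d → ℕ => ENNReal.ofReal r ^ (∑ j, γ j) * ‖F γ (x + t • y)‖ₑ)
      (fun _ _ => zero_le) (mem_multiIdx.2 (by omega))
  | succ k ih =>
    change ENNReal.ofReal r ^ (∑ j, γ j) * ‖∑ i, y i * dirH F x y k (γ + Pi.single i 1) t‖ₑ ≤ _
    calc _ ≤ ENNReal.ofReal r ^ (∑ j, γ j) *
          ∑ i, ‖y i * dirH F x y k (γ + Pi.single i 1) t‖ₑ := by
          gcongr; exact enorm_sum_le _ _
      _ ≤ ∑ i : Fin d, (d : ℝ≥0∞) ^ k * totT n F r (x + t • y) := by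
          rw [Finset.mul_sum]
          apply Finset.sum_le_sum
          intro i _
          have h1 := ih (γ + Pi.single i 1) (by rw [sum_add_single]; omega)
          rw [sum_add_single, pow_succ] at h1
          refine le_trans ?_ h1
          rw [enorm_mul, mul_assoc]
          gcongr
          rw [Real.enorm_eq_ofReal_abs]
          apply ENNReal.ofReal_le_ofReal
          exact (PiLp.norm_apply_le y i).trans hy
      _ = _ := by
          rw [Finset.sum_const, Finset.card_univ, Fintype.card_fin, nsmul_eq_mul, pow_succ]
          ring

lemma ray_bound {d N : ℕ} (hd : 1 ≤ d) {F : (Fin d → ℕ) → Ed d → ℝ}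
    (hF : ∀ γ, ContDiff ℝ (⊤ : ℕ∞) (F γ)) (x y : Ed d) (r : ℝ) (hy : ‖y‖ ≤ r)
    (hp : ∀ γ : Fin d → ℕ, ∑ j, γ j < N + 1 → ∀ i, ∀ t ∈ Icc (0 : ℝ) 1,
      pderivI d i (F γ) (x + t • y) = F (γ + Pi.single i 1) (x + t • y)) :
    ‖F 0 x‖ₑ ≤ ((N + 1 : ℕ) : ℝ≥0∞) * (d : ℝ≥0∞) ^ (N + 1) * (totT (N + 1) F r (x + y) +
      ∫⁻ t in Ioc (0 : ℝ) 1, ENNReal.ofReal (t ^ N) * totT (N + 1) F r (x + t • y)) := by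
  have hd1 : (1 : ℝ≥0∞) ≤ d := by exact_mod_cast hd
  have h1 := taylor_bound (fun k => dirH F x y k 0) N
    (fun k hk t ht => dirH_hasDeriv (n := N + 1) hF x y t (fun γ hγ i => hp γ hγ i t ht) k 0
      (by simp; omega)) (dirH_cont hF x y (N + 1) 0).continuousOn
  have hb : ∀ k, k ≤ N + 1 → ∀ t, ‖dirH F x y k 0 t‖ₑ ≤
      (d : ℝ≥0∞) ^ (N + 1) * totT (N + 1) F r (x + t • y) := by
    intro k hk t
    have := dirH_bound (n := N + 1) F x y t r hy k 0 (by simpa using hk)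
    simp only [Pi.zero_apply, Finset.sum_const_zero, pow_zero, one_mul] at this
    refine this.trans ?_
    gcongr
  have h0 : dirH F x y 0 0 0 = F 0 x := by
    change F 0 (x + (0 : ℝ) • y) = F 0 x
    simp
  rw [h0] at h1
  refine h1.trans ?_
  rw [mul_add]
  gcongr
  · calc _ ≤ ∑ k ∈ Finset.range (N + 1), (d : ℝ≥0∞) ^ (N + 1) * totT (N + 1) F r (x + y) := by
          apply Finset.sum_le_sum
          intro k hk
          have := hb k (by simp at hk; omega) 1
          rwa [one_smul] at this
      _ = _ := by
          rw [Finset.sum_const, Finset.card_range, nsmul_eq_mul]; ring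
  · calc _ ≤ ∫⁻ t in Ioc (0 : ℝ) 1, (d : ℝ≥0∞) ^ (N + 1) *
          (ENNReal.ofReal (t ^ N) * totT (N + 1) F r (x + t • y)) := by
          apply lintegral_mono
          intro t
          dsimp only
          rw [mul_left_comm]
          gcongr
          exact hb (N + 1) le_rfl t
      _ = (d : ℝ≥0∞) ^ (N + 1) * ∫⁻ t in Ioc (0 : ℝ) 1,
          (ENNReal.ofReal (t ^ N) * totT (N + 1) F r (x + t • y)) :=
          lintegral_const_mul' _ _ (ENNReal.pow_ne_top (ENNReal.natCast_ne_top d))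
      _ ≤ _ := by
          gcongr
          apply le_mul_of_one_le_left (zero_le)
          exact_mod_cast Nat.succ_le_succ (Nat.zero_le N)


/-! ### The local Sobolev inequality for smooth families -/

/-- The annulus of outer radius `s` around `x`. -/
def ann {d : ℕ} (x : Ed d) (s : ℝ) : Set (Ed d) := {y | s / 2 ≤ dist y x ∧ dist y x < s}

lemma ann_meas {d : ℕ} (x : Ed d) (s : ℝ) : MeasurableSet (ann x s) := by
  have h1 : IsClosed {y : Ed d | s / 2 ≤ dist y x} :=
    isClosed_le continuous_const (continuous_id.dist continuous_const)
  have h2 : IsOpen {y : Ed d | dist y x < s} :=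
    isOpen_lt (continuous_id.dist continuous_const) continuous_const
  exact h1.measurableSet.inter h2.measurableSet

lemma ann_subset {d : ℕ} (x : Ed d) {s r : ℝ} (h : s ≤ r) : ann x s ⊆ ball x r := by
  intro y hy
  exact mem_ball.2 (hy.2.trans_le h)

lemma lintegral_scale {d : ℕ} (x : Ed d) {s : ℝ} (hs : 0 < s) {f : Ed d → ℝ≥0∞}
    (hf : Measurable f) :
    ∫⁻ z, f (x + s • z) = ENNReal.ofReal ((s ^ d)⁻¹) * ∫⁻ y, f y := by
  have h1 : ∫⁻ z : Ed d, f (x + s • z) = ∫⁻ z, f (x + z) ∂(Measure.map (s • ·) volume) := by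
    have hm : Measurable fun z : Ed d => f (x + z) := hf.comp (measurable_const_add x)
    rw [lintegral_map hm (measurable_const_smul s)]
  rw [h1, Measure.map_addHaar_smul _ hs.ne', lintegral_smul_measure,
    lintegral_add_left_eq_self (fun z => f z) x, finrank_euclideanSpace_fin, smul_eq_mul,
    abs_of_pos (by positivity)]

lemma lintegral_ann {d : ℕ} (x : Ed d) {s : ℝ} (hs : 0 < s) {f : Ed d → ℝ≥0∞}
    (hf : Measurable f) :
    ∫⁻ z in ann 0 1, f (x + s • z) = ENNReal.ofReal ((s ^ d)⁻¹) * ∫⁻ y in ann x s, f y := by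
  rw [← lintegral_indicator (ann_meas _ _), ← lintegral_indicator (ann_meas _ _),
    ← lintegral_scale x hs (hf.indicator (ann_meas x s))]
  congr 1
  funext z
  have hiff : z ∈ ann (0 : Ed d) 1 ↔ x + s • z ∈ ann x s := by
    simp only [ann, mem_ofPred_eq, dist_zero_right, dist_self_add_left, norm_smul, Real.norm_eq_abs,
      abs_of_pos hs]
    constructor
    · rintro ⟨h1, h2⟩; constructor <;> nlinarith
    · rintro ⟨h1, h2⟩
      constructor
      · by_contra h; push Not at h; nlinarith
      · by_contra h; push Not at h; nlinarith
  by_cases hz : z ∈ ann (0 : Ed d) 1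
  · rw [indicator_of_mem hz, indicator_of_mem (hiff.1 hz)]
  · rw [indicator_of_notMem hz, indicator_of_notMem (fun h => hz (hiff.2 h))]

lemma ann_ne_top {d : ℕ} : (volume : Measure (Ed d)) (ann 0 1) ≠ ⊤ :=
  ((measure_mono (ann_subset 0 le_rfl)).trans_lt measure_ball_lt_top).ne

lemma ann_ne_zero {d : ℕ} (hd : 1 ≤ d) : (volume : Measure (Ed d)) (ann 0 1) ≠ 0 := by
  have : Nonempty (Fin d) := ⟨⟨0, hd⟩⟩
  have hsub : ball (EuclideanSpace.single (⟨0, hd⟩ : Fin d) (3 / 4 : ℝ)) (1 / 4) ⊆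
      ann (0 : Ed d) 1 := by
    intro y hy
    rw [mem_ball, dist_eq_norm] at hy
    have h1 : ‖(EuclideanSpace.single (⟨0, hd⟩ : Fin d) (3 / 4 : ℝ) : Ed d)‖ = 3 / 4 := by
      simp
      try norm_num
    have h2 := norm_sub_norm_le y (EuclideanSpace.single (⟨0, hd⟩ : Fin d) (3 / 4 : ℝ))
    have h3 := norm_sub_norm_le (EuclideanSpace.single (⟨0, hd⟩ : Fin d) (3 / 4 : ℝ)) y
    rw [norm_sub_rev] at h3
    simp only [ann, mem_ofPred_eq, dist_zero_right]
    constructor <;> linarith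
  intro h0
  have := measure_mono_null hsub h0
  exact (measure_ball_pos volume _ (by norm_num : (0 : ℝ) < 1 / 4)).ne' this

lemma ann_Lp {d : ℕ} {p : ℝ} (hp : 1 ≤ p) (x : Ed d) {s r : ℝ} (hs : 0 < s) (hsr : s ≤ r)
    {f : Ed d → ℝ≥0∞} (hf : Measurable f) :
    ∫⁻ z in ann 0 1, f (x + s • z) ≤ (volume : Measure (Ed d)) (ann 0 1) ^ (1 - 1 / p) *
      (ENNReal.ofReal (s ^ (-((d : ℝ) / p))) * (∫⁻ y in ball x r, f y ^ p) ^ (1 / p)) := by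
  have hp0 : 0 < p := by linarith
  have hmeas : Measurable fun z : Ed d => f (x + s • z) :=
    hf.comp ((measurable_const_smul s).const_add x)
  have h1 := lintegral_le_Lp ((volume : Measure (Ed d)).restrict (ann 0 1)) hp hmeas.aemeasurable
  rw [Measure.restrict_apply_univ, mul_comm] at h1
  refine h1.trans ?_
  gcongr
  have h2 := lintegral_ann x hs (hf.pow_const p)
  rw [h2, ENNReal.mul_rpow_of_nonneg _ _ (by positivity),
    ENNReal.ofReal_rpow_of_pos (by positivity)]
  gcongr ENNReal.ofReal ?_ * ?_ ^ _
  · rw [← Real.rpow_natCast, ← Real.rpow_neg hs.le, ← Real.rpow_mul hs.le]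
    apply le_of_eq
    congr 1
    ring
  · exact lintegral_mono_set (ann_subset x hsr)

/-- The admissible exponents. -/
def Adm (d N : ℕ) (p : ℝ) : Prop := (d : ℝ) / p < N + 1 ∨ (p = 1 ∧ d = N + 1)

lemma J_bound1 {d N : ℕ} {p : ℝ} (hp : 1 ≤ p) (hN : (d : ℝ) / p < N + 1) :
    ∃ C : ℝ≥0∞, C ≠ ⊤ ∧ ∀ (x : Ed d) (r : ℝ), 0 < r → ∀ f : Ed d → ℝ≥0∞, Measurable f →
      ∫⁻ t in Ioc (0 : ℝ) 1, ENNReal.ofReal (t ^ N) * ∫⁻ z in ann 0 1, f (x + (t * r) • z) ≤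
        C * (ENNReal.ofReal (r ^ (-((d : ℝ) / p))) * (∫⁻ y in ball x r, f y ^ p) ^ (1 / p)) := by
  set M := (volume : Measure (Ed d)) (ann 0 1) ^ (1 - 1 / p) with hM
  have hMt : M ≠ ⊤ := by
    apply ENNReal.rpow_ne_top_of_nonneg _ ann_ne_top
    have : 1 / p ≤ 1 := by rw [div_le_one (by linarith)]; exact hp
    linarith
  set I := ∫⁻ t in Ioc (0 : ℝ) 1, ENNReal.ofReal (t ^ ((N : ℝ) - (d : ℝ) / p)) with hI
  have hIt : I ≠ ⊤ := by
    have h1 : IntervalIntegrable (fun t : ℝ => t ^ ((N : ℝ) - (d : ℝ) / p)) volume 0 1 :=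
      intervalIntegral.intervalIntegrable_rpow' (by linarith)
    rw [intervalIntegrable_iff_integrableOn_Ioc_of_le zero_le_one] at h1
    have h2 := h1.2
    refine ne_of_lt (lt_of_le_of_lt ?_ h2)
    apply setLIntegral_mono' measurableSet_Ioc
    intro t ht
    rw [Real.enorm_eq_ofReal (Real.rpow_nonneg ht.1.le _)]
  refine ⟨M * I, ENNReal.mul_ne_top hMt hIt, ?_⟩
  intro x r hr f hf
  set Q := (∫⁻ y in ball x r, f y ^ p) ^ (1 / p) with hQ
  calc _ ≤ ∫⁻ t in Ioc (0 : ℝ) 1, (ENNReal.ofReal (t ^ ((N : ℝ) - (d : ℝ) / p))) *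
        (M * (ENNReal.ofReal (r ^ (-((d : ℝ) / p))) * Q)) := by
        apply setLIntegral_mono' measurableSet_Ioc
        intro t ht
        have htr : t * r ≤ r := by nlinarith [ht.2]
        have h1 := ann_Lp hp x (mul_pos ht.1 hr) htr hf
        calc _ ≤ ENNReal.ofReal (t ^ N) * (M * (ENNReal.ofReal ((t * r) ^ (-((d : ℝ) / p))) * Q)) := by
              gcongr
          _ = _ := by
              rw [Real.mul_rpow ht.1.le hr.le, ENNReal.ofReal_mul (Real.rpow_nonneg ht.1.le _),
                sub_eq_add_neg, Real.rpow_add ht.1, Real.rpow_natCast,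
                ENNReal.ofReal_mul (pow_nonneg ht.1.le _)]
              ring
    _ = I * (M * (ENNReal.ofReal (r ^ (-((d : ℝ) / p))) * Q)) := by
        rw [lintegral_mul_const]
        exact (measurable_id.pow_const _).ennreal_ofReal
    _ = _ := by ring

lemma J_bound2 {d N : ℕ} (hN : d = N + 1) :
    ∀ (x : Ed d) (r : ℝ), 0 < r → ∀ f : Ed d → ℝ≥0∞, Measurable f →
      ∫⁻ t in Ioc (0 : ℝ) 1, ENNReal.ofReal (t ^ N) * ∫⁻ z in ann 0 1, f (x + (t * r) • z) ≤
        ENNReal.ofReal ((r ^ d)⁻¹) * ∫⁻ y in ball x r, f y := by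
  intro x r hr f hf
  have hS : MeasurableSet {q : ℝ × Ed d | q.1 * r / 2 ≤ dist q.2 x ∧ dist q.2 x < q.1 * r} := by
    have h1 : IsClosed {q : ℝ × Ed d | q.1 * r / 2 ≤ dist q.2 x} :=
      isClosed_le (by fun_prop) (by fun_prop)
    have h2 : IsOpen {q : ℝ × Ed d | dist q.2 x < q.1 * r} :=
      isOpen_lt (by fun_prop) (by fun_prop)
    exact h1.measurableSet.inter h2.measurableSet
  calc _ ≤ ∫⁻ t in Ioc (0 : ℝ) 1, ENNReal.ofReal ((r ^ d)⁻¹) *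
        ∫⁻ y, ENNReal.ofReal t⁻¹ * (ann x (t * r)).indicator f y := by
        apply setLIntegral_mono' measurableSet_Ioc
        intro t ht
        rw [lintegral_ann x (mul_pos ht.1 hr) hf, lintegral_const_mul _ (hf.indicator (ann_meas _ _)),
          lintegral_indicator (ann_meas _ _), ← mul_assoc, ← mul_assoc,
          ← ENNReal.ofReal_mul (pow_nonneg ht.1.le _), ← ENNReal.ofReal_mul (by positivity)]
        apply le_of_eq
        congr 2
        have ht0 := ht.1.ne'
        rw [hN]
        field_simp
        ring
    _ = ENNReal.ofReal ((r ^ d)⁻¹) * ∫⁻ t in Ioc (0 : ℝ) 1,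
        ∫⁻ y, ENNReal.ofReal t⁻¹ * (ann x (t * r)).indicator f y :=
        lintegral_const_mul' _ _ ENNReal.ofReal_ne_top
    _ ≤ ENNReal.ofReal ((r ^ d)⁻¹) * ∫⁻ y in ball x r, f y := by
        gcongr
        rw [lintegral_lintegral_swap]
        · rw [← lintegral_indicator measurableSet_ball]
          apply lintegral_mono
          intro y
          dsimp only
          set ρ := dist y x / r with hρ
          have hρ0 : 0 ≤ ρ := by positivity
          have hpt : ∀ t ∈ Ioc (0 : ℝ) 1, ENNReal.ofReal t⁻¹ * (ann x (t * r)).indicator f y ≤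
              (Ioc ρ (2 * ρ)).indicator (fun _ => ENNReal.ofReal ρ⁻¹ * (ball x r).indicator f y) t := by
            intro t ht
            by_cases hy : y ∈ ann x (t * r)
            · have h1 : ρ < t := by rw [hρ, div_lt_iff₀ hr]; exact hy.2
              have h2 : t ≤ 2 * ρ := by
                have := hy.1
                rw [hρ, ← mul_div_assoc, le_div_iff₀ hr]; linarith
              have h3 : y ∈ ball x r :=
                ann_subset x (by nlinarith [ht.2]) hy
              rw [indicator_of_mem hy, indicator_of_mem (show t ∈ Ioc ρ (2 * ρ) from ⟨h1, h2⟩),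
                indicator_of_mem h3]
              have hρ1 : 0 < ρ := by linarith
              gcongr
            · rw [indicator_of_notMem hy, mul_zero]
              exact zero_le
          calc _ ≤ ∫⁻ t in Ioc (0 : ℝ) 1,
              (Ioc ρ (2 * ρ)).indicator (fun _ => ENNReal.ofReal ρ⁻¹ * (ball x r).indicator f y) t :=
                setLIntegral_mono' measurableSet_Ioc hpt
            _ ≤ ∫⁻ t, (Ioc ρ (2 * ρ)).indicator
                (fun _ => ENNReal.ofReal ρ⁻¹ * (ball x r).indicator f y) t :=
                setLIntegral_le_lintegral _ _
            _ = ENNReal.ofReal ρ⁻¹ * (ball x r).indicator f y * ENNReal.ofReal ρ := by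
                rw [lintegral_indicator measurableSet_Ioc, setLIntegral_const, Real.volume_Ioc]
                congr 2
                ring
            _ = ENNReal.ofReal (ρ⁻¹ * ρ) * (ball x r).indicator f y := by
                rw [ENNReal.ofReal_mul (by positivity)]; ring
            _ ≤ 1 * (ball x r).indicator f y := by
                gcongr
                rw [ENNReal.ofReal_le_one]
                exact inv_mul_le_one
            _ = _ := one_mul _
        · apply Measurable.aemeasurable
          apply Measurable.mul
          · exact (measurable_fst.inv).ennreal_ofReal
          · exact (hf.comp measurable_snd).indicator hS

lemma J_bound {d N : ℕ} {p : ℝ} (hp : 1 ≤ p) (hN : Adm d N p) :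
    ∃ C : ℝ≥0∞, C ≠ ⊤ ∧ ∀ (x : Ed d) (r : ℝ), 0 < r → ∀ f : Ed d → ℝ≥0∞, Measurable f →
      ∫⁻ t in Ioc (0 : ℝ) 1, ENNReal.ofReal (t ^ N) * ∫⁻ z in ann 0 1, f (x + (t * r) • z) ≤
        C * (ENNReal.ofReal (r ^ (-((d : ℝ) / p))) * (∫⁻ y in ball x r, f y ^ p) ^ (1 / p)) := by
  rcases hN with hN | ⟨rfl, hN⟩
  · exact J_bound1 hp hN
  · refine ⟨1, ENNReal.one_ne_top, fun x r hr f hf => ?_⟩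
    have := J_bound2 hN x r hr f hf
    simpa [Real.rpow_neg hr.le] using this

lemma totT_meas {d : ℕ} (n : ℕ) {F : (Fin d → ℕ) → Ed d → ℝ} (r : ℝ)
    (hF : ∀ γ, ContDiff ℝ (⊤ : ℕ∞) (F γ)) : Measurable (totT n F r) := by
  unfold totT
  apply Finset.measurable_fun_sum
  intro γ _
  exact (hF γ).continuous.measurable.enorm.const_mul _

lemma sobolev_smooth {d N : ℕ} (hd : 1 ≤ d) {p : ℝ} (hp : 1 ≤ p) (hN : Adm d N p) :
    ∃ C : ℝ≥0∞, C ≠ ⊤ ∧ ∀ (F : (Fin d → ℕ) → Ed d → ℝ), (∀ γ, ContDiff ℝ (⊤ : ℕ∞) (F γ)) →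
      ∀ (x : Ed d) (r : ℝ), 0 < r →
      (∀ γ : Fin d → ℕ, ∑ j, γ j < N + 1 → ∀ i, ∀ y ∈ ball x r,
        pderivI d i (F γ) y = F (γ + Pi.single i 1) y) →
      ‖F 0 x‖ₑ ^ p ≤ C * (ENNReal.ofReal (r ^ (-(d : ℝ))) *
        ∑ γ ∈ multiIdx d (N + 1), (ENNReal.ofReal r ^ (∑ j, γ j)) ^ p *
          ∫⁻ y in ball x r, ‖F γ y‖ₑ ^ p) := by
  obtain ⟨CJ, hCJ, hJ⟩ := J_bound hp hN
  have hp0 : 0 < p := by linarith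
  set V := (volume : Measure (Ed d)) (ann 0 1) with hV
  have hVt : V ≠ ⊤ := ann_ne_top
  have hV0 : V ≠ 0 := ann_ne_zero hd
  have hMt : V ^ (1 - 1 / p) ≠ ⊤ := by
    apply ENNReal.rpow_ne_top_of_nonneg _ hVt
    have : 1 / p ≤ 1 := by rw [div_le_one (by linarith)]; exact hp
    linarith
  set C1 : ℝ≥0∞ := ((N + 1 : ℕ) : ℝ≥0∞) * (d : ℝ≥0∞) ^ (N + 1) with hC1
  have hC1t : C1 ≠ ⊤ := ENNReal.mul_ne_top (ENNReal.natCast_ne_top _)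
    (ENNReal.pow_ne_top (ENNReal.natCast_ne_top d))
  set C2 : ℝ≥0∞ := V⁻¹ * (C1 * (V ^ (1 - 1 / p) + CJ)) with hC2
  have hC2t : C2 ≠ ⊤ := ENNReal.mul_ne_top (ENNReal.inv_ne_top.2 hV0)
    (ENNReal.mul_ne_top hC1t (ENNReal.add_ne_top.2 ⟨hMt, hCJ⟩))
  set c : ℝ≥0∞ := ((multiIdx d (N + 1)).card : ℝ≥0∞) ^ (p - 1) with hc
  have hct : c ≠ ⊤ := ENNReal.rpow_ne_top_of_nonneg (by linarith) (ENNReal.natCast_ne_top _)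
  refine ⟨C2 ^ p * c, ENNReal.mul_ne_top (ENNReal.rpow_ne_top_of_nonneg hp0.le hC2t) hct, ?_⟩
  intro F hF x r hr hder
  set T := totT (N + 1) F r with hT
  have hTm : Measurable T := totT_meas _ r hF
  set Q := (∫⁻ y in ball x r, T y ^ p) ^ (1 / p) with hQ
  set R := ENNReal.ofReal (r ^ (-((d : ℝ) / p))) with hR
  have hray : ∀ z ∈ ann (0 : Ed d) 1, ‖F 0 x‖ₑ ≤ C1 * (T (x + r • z) +
      ∫⁻ t in Ioc (0 : ℝ) 1, ENNReal.ofReal (t ^ N) * T (x + (t * r) • z)) := by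
    intro z hz
    have hz1 : ‖z‖ < 1 := by simpa using hz.2
    have hn : ‖r • z‖ < r := by
      rw [norm_smul, Real.norm_eq_abs, abs_of_pos hr]; nlinarith
    have := ray_bound (N := N) hd hF x (r • z) r hn.le (by
      intro γ hγ i t ht
      apply hder γ hγ i
      rw [mem_ball, dist_self_add_left, norm_smul, Real.norm_eq_abs, abs_of_nonneg ht.1]
      nlinarith [ht.2, norm_nonneg (r • z), ht.1])
    simpa only [smul_smul] using this
  have hmeas2 : Measurable fun q : Ed d × ℝ => ENNReal.ofReal (q.2 ^ N) * T (x + (q.2 * r) • q.1) := by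
    apply Measurable.mul
    · exact (measurable_snd.pow_const N).ennreal_ofReal
    · apply hTm.comp
      exact Continuous.measurable (by fun_prop)
  have hmeas1 : Measurable fun z : Ed d => T (x + r • z) :=
    hTm.comp (Continuous.measurable (by fun_prop))
  have hintgr : V * ‖F 0 x‖ₑ ≤ C1 * ((V ^ (1 - 1 / p) + CJ) * (R * Q)) := by
    calc V * ‖F 0 x‖ₑ = ∫⁻ z in ann (0 : Ed d) 1, ‖F 0 x‖ₑ := by
          rw [setLIntegral_const, mul_comm]
      _ ≤ ∫⁻ z in ann (0 : Ed d) 1, C1 * (T (x + r • z) +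
          ∫⁻ t in Ioc (0 : ℝ) 1, ENNReal.ofReal (t ^ N) * T (x + (t * r) • z)) :=
          setLIntegral_mono' (ann_meas _ _) hray
      _ = C1 * ((∫⁻ z in ann (0 : Ed d) 1, T (x + r • z)) + ∫⁻ t in Ioc (0 : ℝ) 1,
          ENNReal.ofReal (t ^ N) * ∫⁻ z in ann (0 : Ed d) 1, T (x + (t * r) • z)) := by
          rw [lintegral_const_mul' _ _ hC1t, lintegral_add_left hmeas1,
            lintegral_lintegral_swap hmeas2.aemeasurable]
          congr 3
          funext t
          rw [lintegral_const_mul' _ _ ENNReal.ofReal_ne_top]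
      _ ≤ C1 * (V ^ (1 - 1 / p) * (R * Q) + CJ * (R * Q)) := by
          gcongr
          · exact ann_Lp hp x hr le_rfl hTm
          · exact hJ x r hr T hTm
      _ = _ := by ring
  have hmain : ‖F 0 x‖ₑ ≤ C2 * (R * Q) := by
    calc ‖F 0 x‖ₑ = V⁻¹ * (V * ‖F 0 x‖ₑ) := by
          rw [← mul_assoc, ENNReal.inv_mul_cancel hV0 hVt, one_mul]
      _ ≤ V⁻¹ * (C1 * ((V ^ (1 - 1 / p) + CJ) * (R * Q))) := by gcongr
      _ = _ := by rw [hC2]; ring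
  have hTp : ∫⁻ y in ball x r, T y ^ p ≤ c * ∑ γ ∈ multiIdx d (N + 1),
      (ENNReal.ofReal r ^ (∑ j, γ j)) ^ p * ∫⁻ y in ball x r, ‖F γ y‖ₑ ^ p := by
    calc _ ≤ ∫⁻ y in ball x r, c * ∑ γ ∈ multiIdx d (N + 1),
          (ENNReal.ofReal r ^ (∑ j, γ j)) ^ p * ‖F γ y‖ₑ ^ p := by
          apply lintegral_mono
          intro y
          dsimp only
          refine (ENNReal.rpow_sum_le_const_mul_sum_rpow _ _ hp).trans (le_of_eq ?_)
          congr 1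
          apply Finset.sum_congr rfl
          intro γ _
          rw [ENNReal.mul_rpow_of_nonneg _ _ hp0.le]
      _ = _ := by
          rw [lintegral_const_mul' _ _ hct, lintegral_finsetSum]
          · congr 1
            apply Finset.sum_congr rfl
            intro γ _
            rw [lintegral_const_mul]
            exact (hF γ).continuous.measurable.enorm.pow_const p
          · intro γ _
            exact ((hF γ).continuous.measurable.enorm.pow_const p).const_mul _
  calc ‖F 0 x‖ₑ ^ p ≤ (C2 * (R * Q)) ^ p := by gcongr
    _ = C2 ^ p * (ENNReal.ofReal (r ^ (-(d : ℝ))) * ∫⁻ y in ball x r, T y ^ p) := by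
        rw [ENNReal.mul_rpow_of_nonneg C2 (R * Q) hp0.le, ENNReal.mul_rpow_of_nonneg R Q hp0.le, hR, hQ,
          ← ENNReal.rpow_mul, one_div_mul_cancel hp0.ne', ENNReal.rpow_one,
          ENNReal.ofReal_rpow_of_pos (by positivity), ← Real.rpow_mul hr.le]
        congr 4
        field_simp
    _ ≤ C2 ^ p * (ENNReal.ofReal (r ^ (-(d : ℝ))) * (c * ∑ γ ∈ multiIdx d (N + 1),
      (ENNReal.ofReal r ^ (∑ j, γ j)) ^ p * ∫⁻ y in ball x r, ‖F γ y‖ₑ ^ p)) := by gcongr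
    _ = _ := by ring


/-! ### The local Sobolev inequality for weakly differentiable families -/

lemma exists_exhaustion {d : ℕ} {Ω : Set (Ed d)} (hΩ : IsOpen Ω) :
    ∃ K : ℕ → Set (Ed d), (∀ j, IsCompact (K j)) ∧ (∀ j, K j ⊆ Ω) ∧
      ∀ S, IsCompact S → S ⊆ Ω → ∃ j, S ⊆ K j := by
  have : LocallyCompactSpace Ω := hΩ.locallyCompactSpace
  have : SigmaCompactSpace Ω := inferInstance
  let E : CompactExhaustion Ω := CompactExhaustion.choice Ω
  refine ⟨fun j => Subtype.val '' (E j), fun j => (E.isCompact j).image continuous_subtype_val,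
    fun j => ?_, ?_⟩
  · rintro _ ⟨y, _, rfl⟩
    exact y.2
  · intro S hS hSΩ
    have h1 : IsCompact ((Subtype.val : Ω → Ed d) ⁻¹' S) :=
      Topology.IsInducing.subtypeVal.isCompact_preimage' hS (by simpa using hSΩ)
    obtain ⟨j, hj⟩ := E.exists_superset_of_isCompact h1
    exact ⟨j, fun y hy => ⟨⟨y, hSΩ hy⟩, hj hy, rfl⟩⟩

open Classical in
lemma sobolev_weak {d N : ℕ} (hd : 1 ≤ d) {p : ℝ} (hp : 1 ≤ p) (hN : Adm d N p) :
    ∃ C : ℝ≥0∞, C ≠ ⊤ ∧ ∀ (Ω : Set (Ed d)) (D : (Fin d → ℕ) → Ed d → ℝ), IsOpen Ω →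
      (∀ γ : Fin d → ℕ, ∑ j, γ j ≤ N + 1 → LocallyIntegrableOn (D γ) Ω volume) →
      (∀ γ : Fin d → ℕ, ∑ j, γ j < N + 1 → ∀ i, HasW d Ω i (D γ) (D (γ + Pi.single i 1))) →
      ∀ᵐ x, ∀ r : ℝ, 0 < r → closedBall x (2 * r) ⊆ Ω →
      ‖D 0 x‖ₑ ^ p ≤ C * (ENNReal.ofReal (r ^ (-(d : ℝ))) *
        ∑ γ ∈ multiIdx d (N + 1), (ENNReal.ofReal r ^ (∑ j, γ j)) ^ p *
          ∫⁻ y in ball x (2 * r), ‖D γ y‖ₑ ^ p) := by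
  obtain ⟨C, hC, hS⟩ := sobolev_smooth hd hp hN
  have hp0 : 0 < p := by linarith
  refine ⟨C, hC, ?_⟩
  intro Ω D hΩ hloc hW
  obtain ⟨K, hK, hKΩ, hKS⟩ := exists_exhaustion hΩ
  have hae : ∀ᵐ x, ∀ j, Tendsto (fun k => mol d k ((K j).indicator (D 0)) x) atTop
      (𝓝 ((K j).indicator (D 0) x)) := by
    rw [ae_all_iff]
    intro j
    exact mol_tendsto (indicator_locInt (hloc 0 (by simp)) (hK j) (hKΩ j))
  filter_upwards [hae] with x hx r hr hball
  obtain ⟨j, hj⟩ := hKS _ (isCompact_closedBall x (2 * r)) hball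
  have hxK : x ∈ K j := hj (mem_closedBall_self (by linarith))
  have hlim := hx j
  rw [indicator_of_mem hxK] at hlim
  have hlim2 : Tendsto (fun k => ‖mol d k ((K j).indicator (D 0)) x‖ₑ ^ p) atTop
      (𝓝 (‖D 0 x‖ₑ ^ p)) :=
    ((ENNReal.continuous_rpow_const (y := p)).tendsto _).comp hlim.enorm
  refine le_of_tendsto hlim2 ?_
  have hsmall : ∀ᶠ k : ℕ in atTop, 1 / ((k : ℝ) + 1) < r :=
    tendsto_one_div_add_atTop_nhds_zero_nat.eventually_lt_const hr
  filter_upwards [hsmall] with k hk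
  set F : (Fin d → ℕ) → Ed d → ℝ := fun γ =>
    if ∑ j, γ j ≤ N + 1 then mol d k ((K j).indicator (D γ)) else 0 with hF
  have hFs : ∀ γ : Fin d → ℕ, ∑ j, γ j ≤ N + 1 → F γ = mol d k ((K j).indicator (D γ)) := by
    intro γ hγ
    simp only [hF, if_pos hγ]
  have hsm : ∀ γ, ContDiff ℝ (⊤ : ℕ∞) (F γ) := by
    intro γ
    by_cases h : ∑ j, γ j ≤ N + 1
    · rw [hFs γ h]
      exact mol_smooth k (indicator_locInt (hloc γ h) (hK j) (hKΩ j))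
    · simp only [hF, if_neg h]
      exact contDiff_const
  have hder : ∀ γ : Fin d → ℕ, ∑ j, γ j < N + 1 → ∀ i, ∀ y ∈ ball x r,
      pderivI d i (F γ) y = F (γ + Pi.single i 1) y := by
    intro γ hγ i y hy
    rw [hFs γ hγ.le, hFs _ (by rw [sum_add_single]; omega)]
    apply mol_pderivI (hW γ hγ i) (hK j) (hKΩ j)
    refine Subset.trans ?_ hj
    intro z hz
    rw [mem_closedBall] at hz ⊢
    rw [mem_ball] at hy
    linarith [dist_triangle z y x]
  have := hS F hsm x r hr hder
  rw [hFs 0 (by simp)] at this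
  refine this.trans ?_
  refine mul_le_mul_right (mul_le_mul_right (Finset.sum_le_sum fun γ hγ =>
    mul_le_mul_right ?_ _) _) _
  have hγ' := mem_multiIdx.1 hγ
  rw [hFs γ hγ']
  refine (mol_Lp k (indicator_locInt (hloc γ hγ') (hK j) (hKΩ j)).aestronglyMeasurable hp x r).trans ?_
  refine (lintegral_mono_set (ball_subset_ball (by linarith : r + 1 / ((k : ℝ) + 1) ≤ 2 * r))).trans ?_
  apply lintegral_mono
  intro y
  dsimp only
  gcongr
  by_cases hy : y ∈ K j
  · rw [indicator_of_mem hy]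
  · rw [indicator_of_notMem hy]; simp

/-! ### The weight -/

/-- The properties of the weight `ρ` on `Ω` that are used. -/
structure GoodW (d : ℕ) (Ω : Set (Ed d)) (ρ : Ed d → ℝ) : Prop where
  isOpen : IsOpen Ω
  nonneg : ∀ x, 0 ≤ ρ x
  le_one : ∀ x, ρ x ≤ 1
  lip : ∀ x y, ρ x - ρ y ≤ dist x y
  mem_iff : ∀ x, x ∈ Ω ↔ 0 < ρ x
  cont : Continuous ρ

/-- Projection to the first `d - ℓ` coordinates. -/
def projP (d ℓ : ℕ) (x : Ed d) : Ed d :=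
  WithLp.toLp 2 (fun i => if (i : ℕ) < d - ℓ then x i else 0)

lemma norm_projP (d ℓ : ℕ) (x : Ed d) : ‖projP d ℓ x‖ =
    Real.sqrt (∑ i ∈ Finset.univ.filter (fun i : Fin d => (i : ℕ) < d - ℓ), (x i) ^ 2) := by
  rw [EuclideanSpace.norm_eq, Finset.sum_filter]
  congr 1
  apply Finset.sum_congr rfl
  intro i _
  by_cases h : (i : ℕ) < d - ℓ <;> simp [projP, h]

lemma norm_projP_le (d ℓ : ℕ) (x : Ed d) : ‖projP d ℓ x‖ ≤ ‖x‖ := by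
  rw [norm_projP, EuclideanSpace.norm_eq]
  apply Real.sqrt_le_sqrt
  simp only [Real.norm_eq_abs, sq_abs]
  exact Finset.sum_le_sum_of_subset_of_nonneg (Finset.filter_subset _ _) fun i _ _ => sq_nonneg _

lemma projP_sub (d ℓ : ℕ) (x y : Ed d) : projP d ℓ (x - y) = projP d ℓ x - projP d ℓ y := by
  ext i
  by_cases h : (i : ℕ) < d - ℓ <;> simp [projP, h]

lemma rhoModel_eq (d ℓ : ℕ) (x : Ed d) : rhoModel d ℓ x = min 1 ‖projP d ℓ x‖ := by
  rw [norm_projP]; rfl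

lemma rhoModel_good (d ℓ : ℕ) : GoodW d (ModelDomain d ℓ) (rhoModel d ℓ) := by
  have hlip : ∀ x y, rhoModel d ℓ x - rhoModel d ℓ y ≤ dist x y := by
    intro x y
    rw [rhoModel_eq, rhoModel_eq]
    have h1 := norm_sub_norm_le (projP d ℓ x) (projP d ℓ y)
    rw [← projP_sub] at h1
    have h2 := norm_projP_le d ℓ (x - y)
    rw [dist_eq_norm]
    have h3 := norm_nonneg (x - y)
    rcases le_total 1 ‖projP d ℓ y‖ with h | h
    · rw [min_eq_left h]
      linarith [min_le_left 1 ‖projP d ℓ x‖]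
    · rw [min_eq_right h]
      linarith [min_le_right 1 ‖projP d ℓ x‖]
  have hcont : Continuous (rhoModel d ℓ) := by
    have : LipschitzWith 1 (rhoModel d ℓ) := by
      apply LipschitzWith.of_dist_le_mul
      intro x y
      rw [Real.dist_eq, abs_le]
      have h1 := hlip x y
      have h2 := hlip y x
      rw [dist_comm] at h2
      constructor <;> simp <;> linarith
    exact this.continuous
  have hmem : ∀ x, x ∈ ModelDomain d ℓ ↔ 0 < rhoModel d ℓ x := by
    intro x
    rw [rhoModel_eq, lt_min_iff, norm_pos_iff]
    simp only [zero_lt_one, true_and, ModelDomain, mem_compl_iff, RStar, mem_ofPred_eq]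
    rw [not_iff_not]
    constructor
    · intro h
      ext i
      by_cases hi : (i : ℕ) < d - ℓ
      · simp [projP, h i hi]
      · simp [projP, hi]
    · intro h i hi
      have := congrArg (fun z : Ed d => z i) h
      simpa [projP, hi] using this
  refine ⟨?_, ?_, ?_, hlip, hmem, hcont⟩
  · have : ModelDomain d ℓ = {x | 0 < rhoModel d ℓ x} := by
      ext x; exact hmem x
    rw [this]
    exact isOpen_lt continuous_const hcont
  · intro x
    rw [rhoModel_eq]
    exact le_min zero_le_one (norm_nonneg _)
  · intro x
    exact min_le_left _ _

lemma weight_ptw {d : ℕ} {p A R s w : ℝ} (hp : 1 ≤ p) (hA : (d : ℝ) / p ≤ A) (hR : 0 < R)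
    (hR1 : R ≤ 1) (h1 : R / 2 ≤ s) (h2 : s ≤ 2 * R) (hw : 0 ≤ w) (b g : ℕ) :
    (R / 4) ^ (-(d : ℝ)) * (((R / 4) ^ g) ^ p * w ^ p) ≤
      (4 : ℝ) ^ d * (2 : ℝ) ^ ((|A| + b + g) * p) * (R ^ (-(b : ℝ))) ^ p *
        (s ^ (((b + g : ℕ) : ℝ) - A) * w) ^ p := by
  have hp0 : 0 < p := by linarith
  have hs : 0 < s := by linarith
  set e : ℝ := ((b + g : ℕ) : ℝ) - A with he
  have hee : |e| ≤ |A| + b + g := by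
    rw [he, abs_le]; push_cast
    constructor <;> linarith [neg_abs_le A, le_abs_self A, (Nat.cast_nonneg b : (0:ℝ) ≤ b),
      (Nat.cast_nonneg g : (0:ℝ) ≤ g)]
  -- comparison of the weights at the two points
  have hcomp : R ^ e ≤ 2 ^ (|A| + b + g) * s ^ e := by
    have h3 : (R / s) ^ e ≤ 2 ^ (|A| + b + g) := by
      rcases le_total 0 e with h | h
      · calc (R / s) ^ e ≤ 2 ^ e := by
              apply Real.rpow_le_rpow (by positivity) _ h
              rw [div_le_iff₀ hs]; linarith
          _ ≤ _ := Real.rpow_le_rpow_of_exponent_le (by norm_num) (le_trans (le_abs_self e) hee)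
      · calc (R / s) ^ e = (s / R) ^ (-e) := by
              rw [Real.rpow_neg (by positivity), ← Real.inv_rpow (by positivity), inv_div]
          _ ≤ 2 ^ (-e) := by
              apply Real.rpow_le_rpow (by positivity) _ (by linarith)
              rw [div_le_iff₀ hR]; linarith
          _ ≤ _ := Real.rpow_le_rpow_of_exponent_le (by norm_num) (le_trans (neg_le_abs e) hee)
    rw [Real.div_rpow hR.le hs.le, div_le_iff₀ (by positivity)] at h3
    exact h3
  have hR4 : (R / 4) ^ (-(d : ℝ)) = (4 : ℝ) ^ d * R ^ (-(d : ℝ)) := by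
    rw [Real.div_rpow hR.le (by norm_num), Real.rpow_neg (by norm_num : (0:ℝ) ≤ 4), Real.rpow_natCast]
    field_simp
  have hRd : R ^ (-(d : ℝ)) * (R ^ g) ^ p ≤ (R ^ (-(b : ℝ)) * R ^ e) ^ p := by
    rw [← Real.rpow_natCast R g, ← Real.rpow_add hR, ← Real.rpow_mul hR.le, ← Real.rpow_mul hR.le,
      ← Real.rpow_add hR]
    apply Real.rpow_le_rpow_of_exponent_ge hR hR1
    rw [div_le_iff₀ hp0] at hA
    rw [he]; push_cast
    nlinarith
  calc (R / 4) ^ (-(d : ℝ)) * (((R / 4) ^ g) ^ p * w ^ p)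
      ≤ (4 : ℝ) ^ d * R ^ (-(d : ℝ)) * ((R ^ g) ^ p * w ^ p) := by
        rw [hR4]
        gcongr
        linarith
    _ = (4 : ℝ) ^ d * (R ^ (-(d : ℝ)) * (R ^ g) ^ p) * w ^ p := by ring
    _ ≤ (4 : ℝ) ^ d * ((R ^ (-(b : ℝ)) * (2 ^ (|A| + b + g) * s ^ e)) ^ p) * w ^ p := by
        have : (R ^ (-(b : ℝ)) * R ^ e) ^ p ≤ (R ^ (-(b : ℝ)) * (2 ^ (|A| + b + g) * s ^ e)) ^ p := by
          gcongr
        gcongr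
        exact hRd.trans this
    _ = _ := by
        rw [Real.mul_rpow (by positivity) (by positivity), Real.mul_rpow (by positivity) (by positivity),
          Real.mul_rpow (by positivity) hw, Real.rpow_mul (by norm_num : (0:ℝ) ≤ 2)]
        ring

lemma kIntegrand_nonneg {d : ℕ} {Ω : Set (Ed d)} {ρ : Ed d → ℝ} (hρ : GoodW d Ω ρ) (a p : ℝ)
    (α : Fin d → ℕ) (v : Ed d → ℝ) (x : Ed d) : 0 ≤ kIntegrand d ρ a p α v x :=
  Real.rpow_nonneg (mul_nonneg (Real.rpow_nonneg (hρ.nonneg x) _) (abs_nonneg _)) _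

/-- The `p`-th power of the norm. -/
def Ksum (d : ℕ) (Ω : Set (Ed d)) (ρ : Ed d → ℝ) (m : ℕ) (a p : ℝ)
    (D : (Fin d → ℕ) → Ed d → ℝ) : ℝ :=
  ∑ α ∈ multiIdx d m, ∫ x in Ω, kIntegrand d ρ a p α (D α) x

lemma Ksum_nonneg {d : ℕ} {Ω : Set (Ed d)} {ρ : Ed d → ℝ} (hρ : GoodW d Ω ρ) (m : ℕ) (a p : ℝ)
    (D : (Fin d → ℕ) → Ed d → ℝ) : 0 ≤ Ksum d Ω ρ m a p D :=
  Finset.sum_nonneg fun α _ => integral_nonneg fun x => kIntegrand_nonneg hρ a p α _ x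

lemma sup_bound {d N m : ℕ} (hd : 1 ≤ d) {p A : ℝ} (hp : 1 ≤ p) (hN : Adm d N p)
    (hA : (d : ℝ) / p ≤ A) : ∃ C : ℝ, 0 ≤ C ∧ ∀ (Ω : Set (Ed d)) (ρ : Ed d → ℝ), GoodW d Ω ρ →
      ∀ (v : Ed d → ℝ) (D : (Fin d → ℕ) → Ed d → ℝ), KMemData d Ω ρ (m + (N + 1)) A p v D →
      ∀ β : Fin d → ℕ, ∑ j, β j ≤ m → ∀ᵐ x, x ∈ Ω →
        |D β x| ^ p ≤ C * Ksum d Ω ρ (m + (N + 1)) A p D * (ρ x ^ (-((∑ j, β j : ℕ) : ℝ))) ^ p := by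
  obtain ⟨C, hC, hS⟩ := sobolev_weak hd hp hN
  have hp0 : 0 < p := by linarith
  set M : ℝ := (4 : ℝ) ^ d * (2 : ℝ) ^ ((|A| + m + (N + 1 : ℕ)) * p) with hM
  have hM0 : 0 ≤ M := by positivity
  refine ⟨C.toReal * M, by positivity, ?_⟩
  intro Ω ρ hρ v D hD β hβ
  have hw := hS Ω (fun γ => D (β + γ)) hρ.isOpen
    (fun γ hγ => (hD.1 (β + γ) (mem_multiIdx.2 (by
      simp only [Pi.add_apply, Finset.sum_add_distrib]; omega))).2.1)
    (fun γ hγ i => by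
      rw [← add_assoc]
      exact hD.1.hasW (β + γ) i (by simp only [Pi.add_apply, Finset.sum_add_distrib]; omega))
  filter_upwards [hw] with x hx hxΩ
  have hR : 0 < ρ x := (hρ.mem_iff x).1 hxΩ
  have hball : closedBall x (2 * (ρ x / 4)) ⊆ Ω := by
    intro y hy
    rw [mem_closedBall, dist_comm] at hy
    have := hρ.lip x y
    exact (hρ.mem_iff y).2 (by linarith)
  have h1 := hx (ρ x / 4) (by positivity) hball
  simp only [add_zero] at h1
  set b := ∑ j, β j with hb
  set c : ℝ := M * (ρ x ^ (-(b : ℝ))) ^ p with hc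
  have hc0 : 0 ≤ c := by positivity
  have h2 : ENNReal.ofReal ((ρ x / 4) ^ (-(d : ℝ))) * ∑ γ ∈ multiIdx d (N + 1),
      (ENNReal.ofReal (ρ x / 4) ^ (∑ j, γ j)) ^ p *
        ∫⁻ y in ball x (2 * (ρ x / 4)), ‖D (β + γ) y‖ₑ ^ p ≤
      ENNReal.ofReal c * ENNReal.ofReal (Ksum d Ω ρ (m + (N + 1)) A p D) := by
    calc _ ≤ ∑ γ ∈ multiIdx d (N + 1), ENNReal.ofReal c *
          ENNReal.ofReal (∫ y in Ω, kIntegrand d ρ A p (β + γ) (D (β + γ)) y) := by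
          rw [Finset.mul_sum]
          apply Finset.sum_le_sum
          intro γ hγ
          have hγ' := mem_multiIdx.1 hγ
          have hmem : β + γ ∈ multiIdx d (m + (N + 1)) := mem_multiIdx.2 (by
            simp only [Pi.add_apply, Finset.sum_add_distrib]; omega)
          rw [ofReal_integral_eq_lintegral_ofReal (hD.2 _ hmem)
            (Filter.Eventually.of_forall fun y => kIntegrand_nonneg hρ A p _ _ y),
            ← lintegral_const_mul' _ _ ENNReal.ofReal_ne_top, ← mul_assoc,
            ← lintegral_const_mul' _ _ (ENNReal.mul_ne_top ENNReal.ofReal_ne_top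
              (ENNReal.rpow_ne_top_of_nonneg hp0.le (ENNReal.pow_ne_top ENNReal.ofReal_ne_top)))]
          refine le_trans (setLIntegral_mono' measurableSet_ball ?_)
            (lintegral_mono_set (ball_subset_closedBall.trans hball))
          intro y hy
          rw [mem_ball] at hy
          have e1 := hρ.lip x y
          have e2 := hρ.lip y x
          rw [dist_comm] at e1
          have key := weight_ptw (w := |D (β + γ) y|) hp hA hR (hρ.le_one x) (s := ρ y)
            (by linarith) (by linarith) (abs_nonneg _) b (∑ j, γ j)
          rw [← ENNReal.ofReal_pow (by positivity), ENNReal.ofReal_rpow_of_nonneg (by positivity) hp0.le,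
            Real.enorm_eq_ofReal_abs, ENNReal.ofReal_rpow_of_nonneg (abs_nonneg _) hp0.le,
            ← ENNReal.ofReal_mul (by positivity), ← ENNReal.ofReal_mul (by positivity),
            ← ENNReal.ofReal_mul hc0]
          apply ENNReal.ofReal_le_ofReal
          rw [mul_assoc]
          refine key.trans ?_
          have hk : kIntegrand d ρ A p (β + γ) (D (β + γ)) y =
              (ρ y ^ (((b + ∑ j, γ j : ℕ) : ℝ) - A) * |D (β + γ) y|) ^ p := by
            simp only [kIntegrand, Pi.add_apply, Finset.sum_add_distrib, hb]
          rw [← hk, hc, hM]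
          have hbm : (b : ℝ) ≤ m := by exact_mod_cast hβ
          have hgm : ((∑ j, γ j : ℕ) : ℝ) ≤ (N + 1 : ℕ) := by exact_mod_cast hγ'
          have := kIntegrand_nonneg hρ A p (β + γ) (D (β + γ)) y
          gcongr
          norm_num
      _ = ENNReal.ofReal c * ∑ γ ∈ multiIdx d (N + 1),
          ENNReal.ofReal (∫ y in Ω, kIntegrand d ρ A p (β + γ) (D (β + γ)) y) := by
          rw [Finset.mul_sum]
      _ ≤ _ := by
          gcongr
          rw [Ksum, ENNReal.ofReal_sum_of_nonneg (fun α _ => integral_nonneg fun x =>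
            kIntegrand_nonneg hρ A p α _ x),
            ← Finset.sum_image (s := multiIdx d (N + 1)) (g := fun γ => β + γ)
              (f := fun α => ENNReal.ofReal (∫ y in Ω, kIntegrand d ρ A p α (D α) y))
              (fun _ _ _ _ h => add_left_cancel h)]
          apply Finset.sum_le_sum_of_subset
          intro α hα
          obtain ⟨γ, hγ, rfl⟩ := Finset.mem_image.1 hα
          have hγ' := mem_multiIdx.1 hγ
          exact mem_multiIdx.2 (by simp only [Pi.add_apply, Finset.sum_add_distrib]; omega)
  have h3 : ‖D β x‖ₑ ^ p ≤ C * (ENNReal.ofReal c * ENNReal.ofReal (Ksum d Ω ρ (m + (N + 1)) A p D)) :=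
    h1.trans (by gcongr)
  rw [Real.enorm_eq_ofReal_abs, ENNReal.ofReal_rpow_of_nonneg (abs_nonneg _) hp0.le,
    ← ENNReal.ofReal_toReal hC, ← ENNReal.ofReal_mul hc0, ← ENNReal.ofReal_mul (by positivity),
    ENNReal.ofReal_le_ofReal_iff (mul_nonneg ENNReal.toReal_nonneg
      (mul_nonneg hc0 (Ksum_nonneg hρ _ _ _ _)))] at h3
  refine h3.trans (le_of_eq ?_)
  rw [hc]; ring

lemma locBdd_of_sup {d : ℕ} {Ω : Set (Ed d)} {ρ : Ed d → ℝ} (hρ : GoodW d Ω ρ) {p B e : ℝ}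
    (hp : 0 < p) {f : Ed d → ℝ}
    (h : ∀ᵐ x, x ∈ Ω → |f x| ^ p ≤ B * (ρ x ^ e) ^ p) : LocBdd d Ω f := by
  intro K hK hKΩ
  have hcont : ContinuousOn (fun x => B * (ρ x ^ e) ^ p) K := by
    apply continuousOn_const.mul
    apply ContinuousOn.rpow_const _ (fun x _ => Or.inr hp.le)
    exact hρ.cont.continuousOn.rpow_const fun x hx => Or.inl ((hρ.mem_iff x).1 (hKΩ hx)).ne'
  obtain ⟨M, hM⟩ := hK.bddAbove_image hcont
  refine ⟨(max M 0) ^ (1 / p), by positivity, ?_⟩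
  filter_upwards [h] with x hx hxK
  have h1 := hx (hKΩ hxK)
  have h2 : B * (ρ x ^ e) ^ p ≤ M := hM (mem_image_of_mem _ hxK)
  have h3 : |f x| ^ p ≤ max M 0 := h1.trans (h2.trans (le_max_left _ _))
  calc |f x| = (|f x| ^ p) ^ (1 / p) := by
        rw [← Real.rpow_mul (abs_nonneg _), mul_one_div_cancel hp.ne', Real.rpow_one]
    _ ≤ _ := Real.rpow_le_rpow (by positivity) h3 (by positivity)

/-! ### The multiplier theorem -/

lemma Ksum_congr {d : ℕ} {Ω : Set (Ed d)} {ρ : Ed d → ℝ} (hΩ : IsOpen Ω) {m : ℕ} {a p : ℝ}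
    {u : Ed d → ℝ} {D D' : (Fin d → ℕ) → Ed d → ℝ} (h : IsWeakDerivFamily d Ω m u D)
    (h' : IsWeakDerivFamily d Ω m u D') : Ksum d Ω ρ m a p D = Ksum d Ω ρ m a p D' := by
  apply Finset.sum_congr rfl
  intro α hα
  apply setIntegral_congr_ae hΩ.measurableSet
  filter_upwards [(h α hα).ae_unique hΩ (h' α hα)] with x hx hxΩ
  simp only [kIntegrand, hx hxΩ]

lemma Knorm_eq {d : ℕ} {Ω : Set (Ed d)} {ρ : Ed d → ℝ} (hΩ : IsOpen Ω) {m : ℕ} {a p : ℝ}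
    {u : Ed d → ℝ} {D : (Fin d → ℕ) → Ed d → ℝ} (h : KMemData d Ω ρ m a p u D) :
    Knorm d Ω ρ m a p u = Ksum d Ω ρ m a p D ^ (1 / p) := by
  have hM : MemK d Ω ρ m a p u := ⟨D, h⟩
  rw [Knorm, dif_pos hM, ← Ksum_congr (ρ := ρ) (a := a) (p := p) hΩ hM.choose_spec.1 h.1]
  rfl

lemma list_abs_sum_le {ι : Type*} (L : List ι) (f : ι → ℝ) {T : ℝ} (h : ∀ q ∈ L, |f q| ≤ T) :
    |(L.map f).sum| ≤ L.length * T := by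
  induction L with
  | nil => simp
  | cons q L ih =>
    simp only [List.map_cons, List.sum_cons, List.length_cons, Nat.cast_add, Nat.cast_one]
    have h1 := h q (by simp)
    have h2 := ih fun q' hq' => h q' (by simp [hq'])
    linarith [abs_add_le (f q) (L.map f).sum]

lemma leib_ptw {d m : ℕ} {R a p B : ℝ} (hR : 0 < R) (hp : 0 < p) (hB : 0 ≤ B)
    (U V : (Fin d → ℕ) → ℝ) {n : ℕ} (hn : n ≤ m) (L : List ((Fin d → ℕ) × (Fin d → ℕ)))
    (hL : ∀ q ∈ L, ∑ j, q.1 j + ∑ j, q.2 j = n)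
    (hV : ∀ β : Fin d → ℕ, ∑ j, β j ≤ m → |V β| ^ p ≤ B * (R ^ (-((∑ j, β j : ℕ) : ℝ))) ^ p) :
    (R ^ ((n : ℝ) - a) * |(L.map fun q => V q.1 * U q.2).sum|) ^ p ≤
      (L.length : ℝ) ^ p * (B * ∑ γ ∈ multiIdx d m, (R ^ (((∑ j, γ j : ℕ) : ℝ) - a) * |U γ|) ^ p) := by
  set S : ℝ := ∑ γ ∈ multiIdx d m, (R ^ (((∑ j, γ j : ℕ) : ℝ) - a) * |U γ|) ^ p with hS
  have hS0 : 0 ≤ S := Finset.sum_nonneg fun γ _ => by positivity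
  have hterm : ∀ q ∈ L, |R ^ ((n : ℝ) - a) * (V q.1 * U q.2)| ≤ (B * S) ^ (1 / p) := by
    intro q hq
    have hq' := hL q hq
    have e1 : (n : ℝ) - a = ((∑ j, q.1 j : ℕ) : ℝ) + (((∑ j, q.2 j : ℕ) : ℝ) - a) := by
      rw [← hq']; push_cast; ring
    have h1 : |R ^ ((n : ℝ) - a) * (V q.1 * U q.2)| ^ p ≤ B * S := by
      calc |R ^ ((n : ℝ) - a) * (V q.1 * U q.2)| ^ p
          = (R ^ ((∑ j, q.1 j : ℕ) : ℝ)) ^ p * |V q.1| ^ p *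
              (R ^ (((∑ j, q.2 j : ℕ) : ℝ) - a) * |U q.2|) ^ p := by
            rw [abs_mul, abs_mul, abs_of_pos (by positivity), e1, Real.rpow_add hR,
              ← Real.mul_rpow (by positivity) (by positivity),
              ← Real.mul_rpow (by positivity) (by positivity)]
            congr 1; ring
        _ ≤ (R ^ ((∑ j, q.1 j : ℕ) : ℝ)) ^ p * (B * (R ^ (-((∑ j, q.1 j : ℕ) : ℝ))) ^ p) * S := by
            gcongr
            · exact hV q.1 (by omega)
            · exact Finset.single_le_sum (f := fun γ : Fin d → ℕ =>
                (R ^ (((∑ j, γ j : ℕ) : ℝ) - a) * |U γ|) ^ p) (fun γ _ => by positivity)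
                (mem_multiIdx.2 (by omega : ∑ j, q.2 j ≤ m))
        _ = ((R ^ ((∑ j, q.1 j : ℕ) : ℝ)) * (R ^ (-((∑ j, q.1 j : ℕ) : ℝ)))) ^ p * (B * S) := by
            rw [Real.mul_rpow (by positivity) (by positivity)]; ring
        _ = B * S := by
            rw [← Real.rpow_add hR, add_neg_cancel, Real.rpow_zero, Real.one_rpow, one_mul]
    calc _ = (|R ^ ((n : ℝ) - a) * (V q.1 * U q.2)| ^ p) ^ (1 / p) := by
          rw [← Real.rpow_mul (abs_nonneg _), mul_one_div_cancel hp.ne', Real.rpow_one]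
      _ ≤ _ := Real.rpow_le_rpow (by positivity) h1 (by positivity)
  have h2 := list_abs_sum_le L _ hterm
  rw [List.sum_map_mul_left, abs_mul, abs_of_pos (by positivity)] at h2
  calc _ ≤ ((L.length : ℝ) * (B * S) ^ (1 / p)) ^ p :=
        Real.rpow_le_rpow (by positivity) h2 hp.le
    _ = _ := by
        rw [Real.mul_rpow (by positivity) (by positivity), ← Real.rpow_mul (by positivity),
          one_div_mul_cancel hp.ne', Real.rpow_one]

lemma locInt_congr {d : ℕ} {Ω : Set (Ed d)} (hΩ : IsOpen Ω) {f g : Ed d → ℝ}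
    (hf : LocallyIntegrableOn f Ω volume) (h : ∀ᵐ x, x ∈ Ω → f x = g x) :
    LocallyIntegrableOn g Ω volume := by
  rw [locallyIntegrableOn_iff hΩ.isLocallyClosed] at hf ⊢
  intro K hKΩ hK
  refine (hf K hKΩ hK).congr ?_
  rw [EventuallyEq, ae_restrict_iff' hK.measurableSet]
  filter_upwards [h] with x hx hxK using hx (hKΩ hxK)

theorem mult_core {d N m : ℕ} (hd : 1 ≤ d) {p a : ℝ} (hp : 1 ≤ p) (hN : Adm d N p)
    (hA : (d : ℝ) / p ≤ a + (N + 1 : ℕ)) : ∃ c : ℝ, 0 < c ∧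
      ∀ (Ω : Set (Ed d)) (ρ : Ed d → ℝ), GoodW d Ω ρ → ∀ u v : Ed d → ℝ,
        MemK d Ω ρ m a p u → MemK d Ω ρ (m + (N + 1)) (a + (N + 1 : ℕ)) p v →
        MemK d Ω ρ m a p (u * v) ∧
        Knorm d Ω ρ m a p (u * v) ≤
          c * Knorm d Ω ρ (m + (N + 1)) (a + (N + 1 : ℕ)) p v * Knorm d Ω ρ m a p u := by
  obtain ⟨C, hC, hsup⟩ := sup_bound (m := m) hd hp hN hA
  have hp0 : 0 < p := by linarith
  choose L hL1 hL2 using fun α : Fin d → ℕ => exists_leib (∑ j, α j) α rfl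
  set M : ℝ := ∑ α ∈ multiIdx d m, ((L α).length : ℝ) ^ p with hM
  have hM0 : 0 ≤ M := Finset.sum_nonneg fun α _ => by positivity
  refine ⟨(M * C + 1) ^ (1 / p), by positivity, ?_⟩
  rintro Ω ρ hρ u v ⟨Du, hDu⟩ ⟨Dv, hDv⟩
  have hΩ := hρ.isOpen
  have hb := hsup Ω ρ hρ v Dv hDv
  set Sv := Ksum d Ω ρ (m + (N + 1)) (a + (N + 1 : ℕ)) p Dv with hSv
  set Su := Ksum d Ω ρ m a p Du with hSu
  have hSv0 : 0 ≤ Sv := Ksum_nonneg hρ _ _ _ _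
  have hSu0 : 0 ≤ Su := Ksum_nonneg hρ _ _ _ _
  have hbdd : ∀ α : Fin d → ℕ, ∑ j, α j ≤ m → LocBdd d Ω (Dv α) := fun α hα =>
    locBdd_of_sup hρ hp0 (hb α hα)
  have hu0 := hDu.1 0 (mem_multiIdx.2 (by simp))
  have hv0 := hDv.1 0 (mem_multiIdx.2 (by simp))
  have hprod : LocallyIntegrableOn (fun x => Dv 0 x * Du 0 x) Ω volume :=
    locInt_mul hΩ hv0.2.1 (hbdd 0 (by simp)) hu0.2.1
  have haeq : ∀ᵐ x, x ∈ Ω → Dv 0 x * Du 0 x = (u * v) x := by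
    filter_upwards [hu0.ae_eq_zero_index hΩ, hv0.ae_eq_zero_index hΩ] with x h1 h2 hx
    rw [Pi.mul_apply, h1 hx, h2 hx, mul_comm]
  have h0 : HasWeakDerivOn d Ω 0 (u * v) (fun x => Dv 0 x * Du 0 x) :=
    HasWeakDerivOn.zero_of_ae (locInt_congr hΩ hprod haeq) hprod (by
      filter_upwards [haeq] with x hx hxΩ using (hx hxΩ).symm)
  set D : (Fin d → ℕ) → Ed d → ℝ := fun α => leib Dv Du (L α) with hDdef
  have hDW : IsWeakDerivFamily d Ω m (u * v) D := by
    intro α hα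
    have hα' := mem_multiIdx.1 hα
    exact hL2 α m Ω hΩ Dv Du (u * v) hα' (fun γ i hγ => hDv.1.hasW γ i (by omega))
      (fun γ i hγ => hDu.1.hasW γ i hγ) hbdd h0
  have hball : ∀ᵐ x, ∀ β ∈ multiIdx d m, x ∈ Ω →
      |Dv β x| ^ p ≤ C * Sv * (ρ x ^ (-((∑ j, β j : ℕ) : ℝ))) ^ p := by
    rw [Filter.eventually_all_finset]
    intro β hβ
    exact hb β (mem_multiIdx.1 hβ)
  have hpt : ∀ α ∈ multiIdx d m, ∀ᵐ x ∂(volume.restrict Ω), kIntegrand d ρ a p α (D α) x ≤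
      ((L α).length : ℝ) ^ p * (C * Sv * ∑ γ ∈ multiIdx d m, kIntegrand d ρ a p γ (Du γ) x) := by
    intro α hα
    rw [ae_restrict_iff' hΩ.measurableSet]
    filter_upwards [hball] with x hx hxΩ
    exact leib_ptw ((hρ.mem_iff x).1 hxΩ) hp0 (by positivity) (fun γ => Du γ x) (fun γ => Dv γ x)
      (mem_multiIdx.1 hα) (L α) (hL1 α) (fun β hβ => hx β (mem_multiIdx.2 hβ) hxΩ)
  have hsumI : IntegrableOn (fun x => ∑ γ ∈ multiIdx d m, kIntegrand d ρ a p γ (Du γ) x) Ω volume :=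
    integrable_finsetSum _ fun γ hγ => hDu.2 γ hγ
  have hI : ∀ α ∈ multiIdx d m, IntegrableOn (kIntegrand d ρ a p α (D α)) Ω volume := by
    intro α hα
    refine Integrable.mono' ((hsumI.const_mul (C * Sv)).const_mul (((L α).length : ℝ) ^ p)) ?_ ?_
    · have hDm : AEStronglyMeasurable (D α) (volume.restrict Ω) :=
        (hDW α hα).2.1.aestronglyMeasurable
      have h1 : AEMeasurable (fun x => ρ x ^ (((∑ i, α i : ℕ) : ℝ) - a) * |D α x|)
          (volume.restrict Ω) :=
        (hρ.cont.measurable.pow_const _).aemeasurable.mul hDm.aemeasurable.abs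
      exact (h1.pow_const p).aestronglyMeasurable
    · filter_upwards [hpt α hα] with x hx
      rw [Real.norm_of_nonneg (kIntegrand_nonneg hρ a p α _ x)]
      exact hx
  have hData : KMemData d Ω ρ m a p (u * v) D := ⟨hDW, hI⟩
  refine ⟨⟨D, hData⟩, ?_⟩
  rw [Knorm_eq hΩ hData, Knorm_eq hΩ hDu, Knorm_eq hΩ hDv, ← hSu, ← hSv,
    ← Real.mul_rpow (by positivity) hSv0, ← Real.mul_rpow (by positivity) hSu0]
  apply Real.rpow_le_rpow (Ksum_nonneg hρ _ _ _ _) _ (by positivity)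
  have hkey : Ksum d Ω ρ m a p D ≤ M * (C * Sv * Su) := by
    rw [hM, Finset.sum_mul]
    apply Finset.sum_le_sum
    intro α hα
    calc _ ≤ ∫ x in Ω, ((L α).length : ℝ) ^ p *
          (C * Sv * ∑ γ ∈ multiIdx d m, kIntegrand d ρ a p γ (Du γ) x) :=
          integral_mono_ae (hI α hα)
            ((hsumI.const_mul (C * Sv)).const_mul (((L α).length : ℝ) ^ p)) (hpt α hα)
      _ = _ := by
          rw [integral_const_mul, integral_const_mul, integral_finsetSum _ fun γ hγ => hDu.2 γ hγ]
          rfl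
  nlinarith [mul_nonneg hSv0 hSu0]


/-- Corollary `mult2`: for `m, n ∈ ℕ`: (i) if `max(1, d/n) < p < ∞` and `a ≥ d/p - n`, then
`‖u·v|𝒦^m_{a,p}‖ ≤ c ‖v|𝒦^{m+n}_{a+n,p}‖ ‖u|𝒦^m_{a,p}‖` in the model case;
(ii) the same holds for `p = 1` provided `d ≤ n` and `a ≥ d - n`. -/
theorem statement19 (d ℓ m n : ℕ) (hd : 2 ≤ d) (hl : ℓ < d) (hm : 1 ≤ m) (hn : 1 ≤ n)
    (a : ℝ) :
    (∀ p : ℝ, max 1 ((d : ℝ) / n) < p → (d : ℝ) / p - n ≤ a →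
      ∃ c : ℝ, 0 < c ∧ ∀ u v : Ed d → ℝ,
        MemKM d ℓ m a p u → MemKM d ℓ (m + n) (a + n) p v →
        MemKM d ℓ m a p (u * v) ∧
        KnormM d ℓ m a p (u * v) ≤
          c * KnormM d ℓ (m + n) (a + n) p v * KnormM d ℓ m a p u) ∧
    (d ≤ n → (d : ℝ) - n ≤ a →
      ∃ c : ℝ, 0 < c ∧ ∀ u v : Ed d → ℝ,
        MemKM d ℓ m a 1 u → MemKM d ℓ (m + n) (a + n) 1 v →
        MemKM d ℓ m a 1 (u * v) ∧
        KnormM d ℓ m a 1 (u * v) ≤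
          c * KnormM d ℓ (m + n) (a + n) 1 v * KnormM d ℓ m a 1 u) := by
  obtain ⟨N, rfl⟩ : ∃ N, n = N + 1 := ⟨n - 1, by omega⟩
  have hgood := rhoModel_good d ℓ
  constructor
  · intro p hp ha
    have hp1 : 1 < p := lt_of_le_of_lt (le_max_left _ _) hp
    have hp2 : (d : ℝ) / (N + 1 : ℕ) < p := lt_of_le_of_lt (le_max_right _ _) hp
    have hAdm : Adm d N p := by
      left
      rw [div_lt_iff₀ (by positivity)] at hp2
      rw [div_lt_iff₀ (by linarith)]
      push_cast at hp2
      linarith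
    obtain ⟨c, hc, h⟩ := mult_core (m := m) (a := a) (by omega : 1 ≤ d) hp1.le hAdm (by linarith)
    exact ⟨c, hc, fun u v hu hv => h _ _ hgood u v hu hv⟩
  · intro hdn ha
    have hAdm : Adm d N 1 := by
      rcases hdn.lt_or_eq with h | h
      · left
        rw [div_one]
        exact_mod_cast h
      · right
        exact ⟨rfl, h⟩
    obtain ⟨c, hc, h⟩ := mult_core (m := m) (a := a) (by omega : 1 ≤ d) le_rfl hAdm
      (by rw [div_one]; linarith)
    exact ⟨c, hc, fun u v hu hv => h _ _ hgood u v hu hv⟩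

end
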